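/- arXiv:2304.11089 — 2 statements merged into one kernel-verified Lean document; each statement's English description precedes it below -/
import Mathlib

section
/- Let n > 3k - 2 and k ≥ 2. Suppose F is an intersecting family of k-subsets of [n] that is initial with respect to the shifting partial order. Then the number of sets in F not containing the element 1 is at most C(n-3, k-2). -/
/-- The shifting partial order: `A ≼ B` iff they have the same size and the `i`-th
smallest element of `A` is at most the `i`-th smallest element of `B` for all `i`. -/
def ShiftLE (A B : Finset ℕ) : Prop :=
  A.card = B.card ∧ ∀ i, (A.sort (· ≤ ·)).getD i 0 ≤ (B.sort (· ≤ ·)).getD i 0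

/-- A family of subsets of `[n] = {1,…,n}` is initial if it is downward closed
in the shifting partial order. -/
def InitialFamily (n : ℕ) (𝓕 : Finset (Finset ℕ)) : Prop :=
  ∀ A B : Finset ℕ, A ⊆ Finset.Icc 1 n → ShiftLE A B → B ∈ 𝓕 → A ∈ 𝓕

namespace EKR2

open Finset

/-- `E` is full: all `k`-supersets of `E` in `[m]` are in the family. -/
def Full (𝓕 : Finset (Finset ℕ)) (m k : ℕ) (E : Finset ℕ) : Prop :=
  E ⊆ range m ∧ E.card ≤ k ∧ ∀ F ⊆ range m, F.card = k → E ⊆ F → F ∈ 𝓕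

/-- pairwise 2-intersecting -/
def TwoInt (𝓕 : Finset (Finset ℕ)) : Prop := ∀ A ∈ 𝓕, ∀ B ∈ 𝓕, 2 ≤ (A ∩ B).card

/-- stable under shifting -/
def Stable (𝓕 : Finset (Finset ℕ)) : Prop :=
  ∀ i j : ℕ, i < j → ∀ F ∈ 𝓕, j ∈ F → i ∉ F → insert i (F.erase j) ∈ 𝓕

/-- sets with trace in T -/
def cyl (m k p : ℕ) (T : Finset (Finset ℕ)) : Finset (Finset ℕ) :=
  (powersetCard k (range m)).filter (fun F => F ∩ range p ∈ T)

lemma card_cyl (m k p a : ℕ) (hp : p ≤ m) (hak : a ≤ k) (T : Finset (Finset ℕ))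
    (hT : ∀ A ∈ T, A ⊆ range p ∧ A.card = a) :
    (cyl m k p T).card = T.card * (m - p).choose (k - a) := by
  have hmap : ∀ F ∈ cyl m k p T, F ∩ range p ∈ T := by
    intro F hF; exact (mem_filter.1 hF).2
  rw [card_eq_sum_card_fiberwise hmap, Finset.sum_const_nat]
  intro A hA
  obtain ⟨hA1, hA2⟩ := hT A hA
  have hc : (powersetCard (k - a) (range m \ range p)).card = (m - p).choose (k - a) := by
    rw [card_powersetCard, card_sdiff_of_subset (range_subset_range.2 hp)]; simp
  rw [← hc]
  symm
  apply Finset.card_bij (fun D _ => A ∪ D)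
  · intro D hD
    rw [mem_powersetCard] at hD
    have hdisj : Disjoint A D := by
      rw [disjoint_left]; intro x hx hx'
      have := hD.1 hx'
      have := hA1 hx
      simp_all
    have htr : (A ∪ D) ∩ range p = A := by
      ext x
      have h1 : x ∈ A → x ∈ range p := fun h => hA1 h
      have h2 : x ∈ D → x ∈ range m \ range p := fun h => hD.1 h
      simp only [mem_sdiff, mem_inter, mem_union] at *
      tauto
    simp only [cyl, mem_filter, mem_powersetCard]
    refine ⟨⟨⟨?_, ?_⟩, ?_⟩, htr⟩
    · apply union_subset (hA1.trans (range_subset_range.2 hp)) (hD.1.trans sdiff_subset)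
    · rw [card_union_of_disjoint hdisj]; omega
    · rw [htr]; exact hA
  · intro D hD D' hD' h
    rw [mem_powersetCard] at hD hD'
    ext x
    have h0 : x ∈ A ∪ D ↔ x ∈ A ∪ D' := by rw [h]
    have h1 : x ∈ A → x ∈ range p := fun h => hA1 h
    have h2 : x ∈ D → x ∈ range m \ range p := fun h => hD.1 h
    have h3 : x ∈ D' → x ∈ range m \ range p := fun h => hD'.1 h
    simp only [mem_sdiff, mem_union] at *
    tauto
  · intro F hF
    simp only [cyl, mem_filter, mem_powersetCard] at hF
    obtain ⟨⟨⟨hF1, hF2⟩, hF3⟩, hF4⟩ := hF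
    refine ⟨F \ range p, ?_, ?_⟩
    · rw [mem_powersetCard]
      refine ⟨sdiff_subset_sdiff hF1 (Subset.refl _), ?_⟩
      have := card_sdiff_add_card_inter F (range p)
      rw [hF4] at this; omega
    · rw [← hF4, union_comm]; exact sdiff_union_inter F (range p)

lemma full_inter {𝓕 : Finset (Finset ℕ)} {m k : ℕ} (hm : 2 * k ≤ m) (h2 : TwoInt 𝓕)
    {E E' : Finset ℕ} (hE : Full 𝓕 m k E) (hE' : Full 𝓕 m k E') : 2 ≤ (E ∩ E').card := by
  have hD : (range m \ (E ∪ E')).card = m - (E ∪ E').card := by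
    rw [card_sdiff_of_subset (union_subset hE.1 hE'.1)]; simp
  have hu := card_union_add_card_inter E E'
  have hle : (E ∪ E').card ≤ m := by
    simpa using card_le_card (union_subset hE.1 hE'.1)
  have hk1 := hE.2.1
  have hk2 := hE'.2.1
  obtain ⟨D1, hD1, hc1⟩ := exists_subset_card_eq (s := range m \ (E ∪ E')) (n := k - E.card)
    (by omega)
  obtain ⟨D2, hD2, hc2⟩ := exists_subset_card_eq (s := (range m \ (E ∪ E')) \ D1)
    (n := k - E'.card) (by rw [card_sdiff_of_subset hD1]; omega)
  have e1 : ∀ x ∈ D1, x ∈ range m ∧ x ∉ E ∧ x ∉ E' := by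
    intro x hx; have := hD1 hx; simp only [mem_sdiff, mem_union] at this; tauto
  have e2 : ∀ x ∈ D2, x ∈ range m ∧ x ∉ E ∧ x ∉ E' ∧ x ∉ D1 := by
    intro x hx; have := hD2 hx; simp only [mem_sdiff, mem_union] at this; tauto
  have f1 : E ∪ D1 ∈ 𝓕 := by
    apply hE.2.2 _ _ _ subset_union_left
    · exact union_subset hE.1 (fun x hx => (e1 x hx).1)
    · rw [card_union_of_disjoint]; omega
      rw [disjoint_left]; intro x hx hx'; exact (e1 x hx').2.1 hx
  have f2 : E' ∪ D2 ∈ 𝓕 := by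
    apply hE'.2.2 _ _ _ subset_union_left
    · exact union_subset hE'.1 (fun x hx => (e2 x hx).1)
    · rw [card_union_of_disjoint]; omega
      rw [disjoint_left]; intro x hx hx'; exact (e2 x hx').2.2.1 hx
  have := h2 _ f1 _ f2
  refine this.trans (card_le_card ?_)
  intro x hx
  have := e1 x
  have := e2 x
  simp only [mem_inter, mem_union] at *
  tauto

lemma full_shift {𝓕 : Finset (Finset ℕ)} {m k : ℕ} (hs : Stable 𝓕)
    {E : Finset ℕ} (hE : Full 𝓕 m k E) {i j : ℕ} (hij : i < j) (hj : j ∈ E) (hi : i ∉ E) :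
    Full 𝓕 m k (insert i (E.erase j)) := by
  have hjm : j < m := by simpa using hE.1 hj
  refine ⟨?_, ?_, ?_⟩
  · intro x hx
    rcases mem_insert.1 hx with rfl | hx
    · simp; omega
    · exact hE.1 (mem_of_mem_erase hx)
  · rw [card_insert_of_notMem (by simp [hi]), card_erase_of_mem hj]
    have := hE.2.1
    have : 0 < E.card := card_pos.2 ⟨j, hj⟩
    omega
  · intro B hB hBk hEB
    have hiB : i ∈ B := hEB (mem_insert_self _ _)
    by_cases hjB : j ∈ B
    · apply hE.2.2 B hB hBk
      intro x hx
      by_cases hxj : x = j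
      · rwa [hxj]
      · exact hEB (mem_insert_of_mem (mem_erase.2 ⟨hxj, hx⟩))
    · have hmem : insert j (B.erase i) ∈ 𝓕 := by
        apply hE.2.2
        · intro x hx
          rcases mem_insert.1 hx with rfl | hx
          · simpa using hjm
          · exact hB (mem_of_mem_erase hx)
        · rw [card_insert_of_notMem (by simp [hjB]), card_erase_of_mem hiB]
          have : 0 < B.card := card_pos.2 ⟨i, hiB⟩
          omega
        · intro x hx
          by_cases hxj : x = j
          · rw [hxj]; exact mem_insert_self _ _
          · refine mem_insert_of_mem (mem_erase.2 ⟨?_, hEB (mem_insert_of_mem (mem_erase.2 ⟨hxj, hx⟩))⟩)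
            rintro rfl; exact hi hx
      have := hs i j hij _ hmem (mem_insert_self _ _) (by simp; omega)
      convert this using 1
      ext x
      simp only [mem_insert, mem_erase]
      by_cases h1 : x = i
      · subst h1; simp [hiB]
      · by_cases h2 : x = j
        · subst h2; simp [hjB, h1]
        · simp [h1, h2]

lemma exists_stable (m k : ℕ) : ∃ 𝓕 ⊆ powersetCard k (range m), TwoInt 𝓕 ∧ Stable 𝓕 ∧
    ∀ 𝓖 ⊆ powersetCard k (range m), TwoInt 𝓖 → 𝓖.card ≤ 𝓕.card := by
  classical
  let Ω := (powersetCard k (range m)).powerset.filter TwoInt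
  have hΩ : Ω.Nonempty := ⟨∅, by simp [Ω, TwoInt]⟩
  obtain ⟨𝓜, hM, hMmax⟩ := exists_max_image Ω card hΩ
  let Ω' := Ω.filter (fun 𝓖 => 𝓖.card = 𝓜.card)
  obtain ⟨𝓕, hF, hmin⟩ := exists_min_image Ω' (fun 𝓖 => ∑ A ∈ 𝓖, ∑ x ∈ A, x)
    ⟨𝓜, by simp [Ω', hM]⟩
  simp only [Ω', Ω, mem_filter, mem_powerset] at hF hmin hMmax
  obtain ⟨⟨hFs, h2⟩, hFc⟩ := hF
  refine ⟨𝓕, hFs, h2, ?_, fun 𝓖 h1 h2 => hFc ▸ hMmax 𝓖 ⟨h1, h2⟩⟩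
  intro i j hij F0 hF0 hj0 hi0
  by_contra hnot
  let φ : Finset ℕ → Finset ℕ := fun F =>
    if j ∈ F ∧ i ∉ F ∧ insert i (F.erase j) ∉ 𝓕 then insert i (F.erase j) else F
  have hφ1 : ∀ F, (j ∈ F ∧ i ∉ F ∧ insert i (F.erase j) ∉ 𝓕) → φ F = insert i (F.erase j) :=
    fun F h => if_pos h
  have hφ2 : ∀ F, ¬ (j ∈ F ∧ i ∉ F ∧ insert i (F.erase j) ∉ 𝓕) → φ F = F := fun F h => if_neg h
  have hinj : Set.InjOn φ 𝓕 := by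
    intro A hA B hB hAB
    by_cases hcA : j ∈ A ∧ i ∉ A ∧ insert i (A.erase j) ∉ 𝓕 <;>
    by_cases hcB : j ∈ B ∧ i ∉ B ∧ insert i (B.erase j) ∉ 𝓕
    · rw [hφ1 _ hcA, hφ1 _ hcB] at hAB
      ext x
      have := Finset.ext_iff.1 hAB x
      simp only [mem_insert, mem_erase] at this
      by_cases h1 : x = i
      · subst h1; tauto
      · by_cases h2 : x = j
        · subst h2; tauto
        · tauto
    · rw [hφ1 _ hcA, hφ2 _ hcB] at hAB
      exact absurd (hAB ▸ hB) hcA.2.2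
    · rw [hφ2 _ hcA, hφ1 _ hcB] at hAB
      exact absurd (hAB ▸ hA) hcB.2.2
    · rwa [hφ2 _ hcA, hφ2 _ hcB] at hAB
  have hcardins : ∀ A : Finset ℕ, j ∈ A → i ∉ A → (insert i (A.erase j)).card = A.card := by
    intro A hj hi
    rw [card_insert_of_notMem (by simp [hi]), card_erase_of_mem hj]
    have : 0 < A.card := card_pos.2 ⟨j, hj⟩
    omega
  have hmixed : ∀ A ∈ 𝓕, ∀ B ∈ 𝓕, (j ∈ A ∧ i ∉ A ∧ insert i (A.erase j) ∉ 𝓕) →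
      ¬ (j ∈ B ∧ i ∉ B ∧ insert i (B.erase j) ∉ 𝓕) →
      2 ≤ (insert i (A.erase j) ∩ B).card := by
    intro A hA B hB hcA hcB
    by_cases hjB : j ∈ B
    · by_cases hiB : i ∈ B
      · have e : insert i (A.erase j) ∩ B = insert i ((A ∩ B).erase j) := by
          ext x; simp only [mem_inter, mem_insert, mem_erase]
          by_cases h1 : x = i
          · subst h1; tauto
          · tauto
        rw [e, card_insert_of_notMem (by simp [hcA.2.1]), card_erase_of_mem (by simp [hjB, hcA.1])]
        have := h2 A hA B hB
        omega
      · have hB' : insert i (B.erase j) ∈ 𝓕 := by tauto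
        refine (h2 A hA _ hB').trans (card_le_card ?_)
        intro x
        simp only [mem_inter, mem_insert, mem_erase]
        rintro ⟨h3, rfl | h4⟩
        · exact absurd h3 hcA.2.1
        · tauto
    · refine (h2 A hA B hB).trans (card_le_card ?_)
      intro x
      simp only [mem_inter, mem_insert, mem_erase]
      rintro ⟨h3, h4⟩
      have : x ≠ j := by rintro rfl; exact hjB h4
      tauto
  have hnew : (𝓕.image φ ⊆ powersetCard k (range m) ∧ TwoInt (𝓕.image φ)) ∧
      (𝓕.image φ).card = 𝓜.card := by
    refine ⟨⟨?_, ?_⟩, ?_⟩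
    · intro G hG
      obtain ⟨A, hA, rfl⟩ := mem_image.1 hG
      have hA' := mem_powersetCard.1 (hFs hA)
      by_cases hcA : j ∈ A ∧ i ∉ A ∧ insert i (A.erase j) ∉ 𝓕
      · rw [hφ1 _ hcA, mem_powersetCard, hcardins _ hcA.1 hcA.2.1]
        refine ⟨?_, hA'.2⟩
        intro x hx
        rcases mem_insert.1 hx with rfl | hx
        · have := hA'.1 hcA.1
          simp at this ⊢; omega
        · exact hA'.1 (mem_of_mem_erase hx)
      · rw [hφ2 _ hcA]; exact hFs hA
    · intro G hG H hH
      obtain ⟨A, hA, rfl⟩ := mem_image.1 hG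
      obtain ⟨B, hB, rfl⟩ := mem_image.1 hH
      by_cases hcA : j ∈ A ∧ i ∉ A ∧ insert i (A.erase j) ∉ 𝓕 <;>
      by_cases hcB : j ∈ B ∧ i ∉ B ∧ insert i (B.erase j) ∉ 𝓕
      · rw [hφ1 _ hcA, hφ1 _ hcB]
        have e : insert i (A.erase j) ∩ insert i (B.erase j) = insert i ((A ∩ B).erase j) := by
          ext x; simp only [mem_inter, mem_insert, mem_erase]; tauto
        rw [e, hcardins _ (by simp [hcA.1, hcB.1]) (by simp [hcA.2.1])]
        exact h2 A hA B hB
      · rw [hφ1 _ hcA, hφ2 _ hcB]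
        exact hmixed A hA B hB hcA hcB
      · rw [hφ2 _ hcA, hφ1 _ hcB, inter_comm]
        exact hmixed B hB A hA hcB hcA
      · rw [hφ2 _ hcA, hφ2 _ hcB]; exact h2 A hA B hB
    · rw [card_image_of_injOn hinj, hFc]
  have hle := hmin _ hnew
  rw [sum_image hinj] at hle
  have hdec : ∀ A : Finset ℕ, (j ∈ A ∧ i ∉ A ∧ insert i (A.erase j) ∉ 𝓕) →
      ∑ x ∈ φ A, x < ∑ x ∈ A, x := by
    intro A hcA
    rw [hφ1 _ hcA, sum_insert (by simp [hcA.2.1]), ← add_sum_erase A (fun x => x) hcA.1]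
    omega
  refine absurd hle (not_le.2 (sum_lt_sum ?_ ⟨F0, hF0, hdec F0 ⟨hj0, hi0, hnot⟩⟩))
  intro A hA
  by_cases hcA : j ∈ A ∧ i ∉ A ∧ insert i (A.erase j) ∉ 𝓕
  · exact (hdec A hcA).le
  · rw [hφ2 _ hcA]

/-- boundary sets -/
def Bd (𝓕 : Finset (Finset ℕ)) (m k l : ℕ) (A : Finset ℕ) : Prop :=
  A ⊆ range l ∧ Full 𝓕 m k (insert l A) ∧ ¬ Full 𝓕 m k A

section main
variable {𝓕 : Finset (Finset ℕ)} {m k l : ℕ}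

lemma bd_card {A : Finset ℕ} (hA : Bd 𝓕 m k l A) : A.card + 1 ≤ k := by
  have hl : l ∉ A := fun h => by simpa using hA.1 h
  have := hA.2.1.2.1
  rwa [card_insert_of_notMem hl] at this

lemma bd_pair (hm : 2 * k ≤ m) (h2 : TwoInt 𝓕) (hs : Stable 𝓕) {A B : Finset ℕ}
    (hA : Bd 𝓕 m k l A) (hB : Bd 𝓕 m k l B) (h : ¬ 2 ≤ (A ∩ B).card) :
    A ∪ B = range l ∧ A.card + B.card = l + 1 := by
  have hlA : l ∉ A := fun h => by simpa using hA.1 h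
  have hlB : l ∉ B := fun h => by simpa using hB.1 h
  have h1 : 2 ≤ (insert l A ∩ insert l B).card := full_inter hm h2 hA.2.1 hB.2.1
  rw [← insert_inter_distrib, card_insert_of_notMem (by simp [hlA])] at h1
  have hU : A ∪ B = range l := by
    apply Subset.antisymm (union_subset hA.1 hB.1)
    intro j hj
    by_contra hjn
    have hjl : j < l := by simpa using hj
    have hjA : j ∉ A := fun h => hjn (mem_union_left _ h)
    have hjB : j ∉ B := fun h => hjn (mem_union_right _ h)
    have hf := full_shift hs hA.2.1 hjl (mem_insert_self l A) (by simp [hjA]; omega)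
    rw [erase_insert hlA] at hf
    have h3 := full_inter hm h2 hf hB.2.1
    apply h
    refine h3.trans (card_le_card ?_)
    intro x
    simp only [mem_inter, mem_insert]
    rintro ⟨rfl | h4, rfl | h5⟩
    · omega
    · exact absurd h5 hjB
    · exact absurd h4 hlA
    · exact ⟨h4, h5⟩
  refine ⟨hU, ?_⟩
  have := card_union_add_card_inter A B
  rw [hU, card_range] at this
  omega

lemma bd_full (hm : 2 * k ≤ m) (h2 : TwoInt 𝓕) {A C : Finset ℕ}
    (hA : Bd 𝓕 m k l A) (hC : Full 𝓕 m k C) (hCl : C ⊆ range l) : 2 ≤ (A ∩ C).card := by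
  have hlC : l ∉ C := fun h => by simpa using hCl h
  have := full_inter hm h2 hA.2.1 hC
  rwa [insert_inter_of_notMem hlC] at this

lemma trace_bd (hgen : ∀ F ∈ 𝓕, Full 𝓕 m k (F ∩ range (l + 1))) {F : Finset ℕ} (hF : F ∈ 𝓕)
    (hn : ¬ Full 𝓕 m k (F ∩ range l)) : l ∈ F ∧ Bd 𝓕 m k l (F ∩ range l) := by
  have hf := hgen F hF
  have hl : l ∈ F := by
    by_contra hl
    rw [range_add_one, inter_insert_of_notMem hl] at hf
    exact hn hf
  rw [range_add_one, inter_insert_of_mem hl] at hf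
  exact ⟨hl, inter_subset_right, hf, hn⟩

lemma exists_partner (hm : 2 * k ≤ m) (hlm : l + 1 ≤ m) (hF : 𝓕 ⊆ powersetCard k (range m))
    (h2 : TwoInt 𝓕)
    (hmax : ∀ 𝓖 ⊆ powersetCard k (range m), TwoInt 𝓖 → 𝓖.card ≤ 𝓕.card)
    (hgen : ∀ F ∈ 𝓕, Full 𝓕 m k (F ∩ range (l + 1))) {A : Finset ℕ} (hA : Bd 𝓕 m k l A) :
    ∃ B, Bd 𝓕 m k l B ∧ ¬ 2 ≤ (A ∩ B).card := by
  by_contra! hno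
  apply hA.2.2
  refine ⟨hA.1.trans (range_subset_range.2 (by omega)), by have := bd_card hA; omega, ?_⟩
  intro B hB hBk hAB
  by_contra hBF
  have hcross : ∀ G ∈ 𝓕, 2 ≤ (B ∩ G).card := by
    intro G hG
    have : 2 ≤ (A ∩ (G ∩ range l)).card := by
      by_cases hfu : Full 𝓕 m k (G ∩ range l)
      · exact bd_full hm h2 hA hfu inter_subset_right
      · exact hno _ (trace_bd hgen hG hfu).2
    refine this.trans (card_le_card ?_)
    exact inter_subset_inter hAB inter_subset_left
  have hself : 2 ≤ B.card := by
    have := hno A hA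
    rw [inter_self] at this
    exact this.trans (card_le_card hAB)
  have := hmax (insert B 𝓕) (insert_subset (mem_powersetCard.2 ⟨hB, hBk⟩) hF) (by
    intro G hG H hH
    rcases mem_insert.1 hG with hG' | hG' <;> rcases mem_insert.1 hH with hH' | hH'
    · rw [hG', hH', inter_self]; exact hself
    · rw [hG']; exact hcross H hH'
    · rw [hH', inter_comm]; exact hcross G hG'
    · exact h2 G hG' H hH')
  rw [card_insert_of_notMem hBF] at this
  omega

/-- boundary family of a given size -/
noncomputable def bdF (𝓕 : Finset (Finset ℕ)) (m k l a : ℕ) : Finset (Finset ℕ) := by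
  classical exact (powersetCard a (range l)).filter (Bd 𝓕 m k l)

lemma mem_bdF {a : ℕ} {A : Finset ℕ} : A ∈ bdF 𝓕 m k l a ↔ Bd 𝓕 m k l A ∧ A.card = a := by
  classical
  simp only [bdF, mem_filter, mem_powersetCard]
  exact ⟨fun h => ⟨h.2, h.1.2⟩, fun h => ⟨⟨h.1.1, h.2⟩, h.1⟩⟩

lemma exchange (hm : 2 * k ≤ m) (hlm : l + 1 ≤ m) (hF : 𝓕 ⊆ powersetCard k (range m))
    (h2 : TwoInt 𝓕) (hs : Stable 𝓕)
    (hmax : ∀ 𝓖 ⊆ powersetCard k (range m), TwoInt 𝓖 → 𝓖.card ≤ 𝓕.card)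
    (hgen : ∀ F ∈ 𝓕, Full 𝓕 m k (F ∩ range (l + 1))) {a b : ℕ} (hab : a + b = l + 1)
    (hbk : b + 1 ≤ k)
    (S : Finset (Finset ℕ)) (hS : S ⊆ bdF 𝓕 m k l a) (hSS : TwoInt S)
    (Add : Finset (Finset ℕ)) (hAddS : Add ⊆ cyl m k l S)
    (hdis : ∀ F ∈ Add, F ∈ 𝓕 → F ∩ range l ∈ bdF 𝓕 m k l b) :
    Add.card ≤ (bdF 𝓕 m k l b).card * (m - (l + 1)).choose (k - (b + 1)) := by
  classical
  set R := 𝓕.filter (fun F => F ∩ range l ∈ bdF 𝓕 m k l b) with hR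
  have hRc : R.card ≤ (bdF 𝓕 m k l b).card * (m - (l + 1)).choose (k - (b + 1)) := by
    have hinj : Set.InjOn (insert l) (bdF 𝓕 m k l b : Set (Finset ℕ)) := by
      intro A hA B hB hAB
      have hA := (mem_bdF.1 hA).1.1
      have hB := (mem_bdF.1 hB).1.1
      have hlA : l ∉ A := fun h => by simpa using hA h
      have hlB : l ∉ B := fun h => by simpa using hB h
      rw [← erase_insert hlA, ← erase_insert hlB, hAB]
    rw [← card_image_of_injOn hinj, ← card_cyl m k (l + 1) (b + 1) hlm hbk]
    · apply card_le_card
      intro F hFR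
      rw [hR, mem_filter] at hFR
      have hb := (mem_bdF.1 hFR.2).1
      have := (trace_bd hgen hFR.1 hb.2.2).1
      refine mem_filter.2 ⟨hF hFR.1, ?_⟩
      rw [range_add_one, inter_insert_of_mem this]
      exact mem_image_of_mem _ hFR.2
    · intro A hA
      obtain ⟨B, hB, rfl⟩ := mem_image.1 hA
      have hB := mem_bdF.1 hB
      have hlB : l ∉ B := fun h => by simpa using hB.1.1 h
      refine ⟨?_, by rw [card_insert_of_notMem hlB, hB.2]⟩
      rw [range_add_one]; exact insert_subset_insert _ hB.1.1
  refine le_trans ?_ hRc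
  have hd : Disjoint (𝓕 \ R) Add := by
    rw [disjoint_left]; intro F h1 h3
    rw [mem_sdiff] at h1
    exact h1.2 (mem_filter.2 ⟨h1.1, hdis F h3 h1.1⟩)
  have hcross : ∀ F ∈ Add, ∀ G ∈ 𝓕 \ R, 2 ≤ (F ∩ G).card := by
    intro F hFA G hG
    rw [mem_sdiff] at hG
    have hFS := (mem_filter.1 (hAddS hFA)).2
    have hFb := mem_bdF.1 (hS hFS)
    have : 2 ≤ ((F ∩ range l) ∩ (G ∩ range l)).card := by
      by_cases hfu : Full 𝓕 m k (G ∩ range l)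
      · exact bd_full hm h2 hFb.1 hfu inter_subset_right
      · have hGb := (trace_bd hgen hG.1 hfu).2
        by_contra hcon
        have h5 := (bd_pair hm h2 hs hFb.1 hGb hcon).2
        exact hG.2 (mem_filter.2 ⟨hG.1, mem_bdF.2 ⟨hGb, by have := hFb.2; omega⟩⟩)
    exact this.trans (card_le_card (inter_subset_inter inter_subset_left inter_subset_left))
  have := hmax ((𝓕 \ R) ∪ Add)
    (union_subset (sdiff_subset.trans hF) (hAddS.trans (filter_subset _ _))) (by
      intro G hG H hH
      rcases mem_union.1 hG with hG | hG <;> rcases mem_union.1 hH with hH | hH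
      · exact h2 G (mem_sdiff.1 hG).1 H (mem_sdiff.1 hH).1
      · rw [inter_comm]; exact hcross H hH G hG
      · exact hcross G hG H hH
      · have := hSS _ (mem_filter.1 (hAddS hG)).2 _ (mem_filter.1 (hAddS hH)).2
        exact this.trans (card_le_card (inter_subset_inter inter_subset_left inter_subset_left)))
  rw [card_union_of_disjoint hd, card_sdiff_of_subset (filter_subset _ _), ← hR] at this
  have hRF : R.card ≤ 𝓕.card := card_le_card (filter_subset _ _)
  omega

lemma ineq_ne (hm : 2 * k ≤ m) (hlm : l + 1 ≤ m) (hF : 𝓕 ⊆ powersetCard k (range m))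
    (h2 : TwoInt 𝓕) (hs : Stable 𝓕)
    (hmax : ∀ 𝓖 ⊆ powersetCard k (range m), TwoInt 𝓖 → 𝓖.card ≤ 𝓕.card)
    (hgen : ∀ F ∈ 𝓕, Full 𝓕 m k (F ∩ range (l + 1))) {a b : ℕ} (hab : a + b = l + 1)
    (hak : a + 1 ≤ k) (hbk : b + 1 ≤ k) (hne : a ≠ b) :
    (bdF 𝓕 m k l a).card * (m - (l + 1)).choose (k - a) ≤
      (bdF 𝓕 m k l b).card * (m - (l + 1)).choose (k - (b + 1)) := by
  rw [← card_cyl m k (l + 1) a hlm (by omega) (bdF 𝓕 m k l a)]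
  · have hl : ∀ F ∈ cyl m k (l + 1) (bdF 𝓕 m k l a), F ∩ range (l + 1) = F ∩ range l := by
      intro F hFc
      have h3 := (mem_bdF.1 (mem_filter.1 hFc).2).1.1
      rw [range_add_one]
      apply inter_insert_of_notMem
      intro hl
      have := h3 (mem_inter.2 ⟨hl, mem_range.2 (Nat.lt_succ_self l)⟩)
      simp at this
    apply exchange hm hlm hF h2 hs hmax hgen hab hbk (bdF 𝓕 m k l a) (Subset.refl _)
    · intro A hA B hB
      by_contra hcon
      have hA := mem_bdF.1 hA
      have hB := mem_bdF.1 hB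
      have := (bd_pair hm h2 hs hA.1 hB.1 hcon).2
      omega
    · intro F hFc
      refine mem_filter.2 ⟨(mem_filter.1 hFc).1, ?_⟩
      rw [← hl F hFc]; exact (mem_filter.1 hFc).2
    · intro F hFc hFF
      exact absurd (hgen F hFF) (mem_bdF.1 (mem_filter.1 hFc).2).1.2.2
  · intro A hA
    have hA := mem_bdF.1 hA
    exact ⟨hA.1.1.trans (range_subset_range.2 (by omega)), hA.2⟩

lemma ineq_eq (hm : 2 * k ≤ m) (hlm : l + 1 ≤ m) (hF : 𝓕 ⊆ powersetCard k (range m))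
    (h2 : TwoInt 𝓕) (hs : Stable 𝓕)
    (hmax : ∀ 𝓖 ⊆ powersetCard k (range m), TwoInt 𝓖 → 𝓖.card ≤ 𝓕.card)
    (hgen : ∀ F ∈ 𝓕, Full 𝓕 m k (F ∩ range (l + 1))) {a : ℕ} (hab : a + a = l + 1)
    (hak : a + 1 ≤ k) {p : ℕ} (hp : p ∈ range l) :
    ((bdF 𝓕 m k l a).filter (fun A => p ∉ A)).card * (m - l).choose (k - a) ≤
      (bdF 𝓕 m k l a).card * (m - (l + 1)).choose (k - (a + 1)) := by
  rw [← card_cyl m k l a (by omega) (by omega) ((bdF 𝓕 m k l a).filter (fun A => p ∉ A))]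
  · apply exchange hm hlm hF h2 hs hmax hgen hab hak _ (filter_subset _ _) _ _ (Subset.refl _)
    · intro F hFc _
      exact (mem_filter.1 (mem_filter.1 hFc).2).1
    · intro A hA B hB
      by_contra hcon
      rw [mem_filter] at hA hB
      have := (bd_pair hm h2 hs (mem_bdF.1 hA.1).1 (mem_bdF.1 hB.1).1 hcon).1
      rw [← this, mem_union] at hp
      tauto
  · intro A hA
    have hA := mem_bdF.1 (mem_filter.1 hA).1
    exact ⟨hA.1.1, hA.2⟩

lemma no_bd (hk : 2 ≤ k) (hm3 : 3 * k ≤ m + 2) (hl2 : 2 ≤ l) (hlm : l + 1 ≤ m)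
    (hF : 𝓕 ⊆ powersetCard k (range m))
    (h2 : TwoInt 𝓕) (hs : Stable 𝓕)
    (hmax : ∀ 𝓖 ⊆ powersetCard k (range m), TwoInt 𝓖 → 𝓖.card ≤ 𝓕.card)
    (hgen : ∀ F ∈ 𝓕, Full 𝓕 m k (F ∩ range (l + 1))) (A : Finset ℕ) : ¬ Bd 𝓕 m k l A := by
  intro hA
  have hm : 2 * k ≤ m := by omega
  obtain ⟨B, hB, hAB⟩ := exists_partner hm hlm hF h2 hmax hgen hA
  have hsum := (bd_pair hm h2 hs hA hB hAB).2
  have hak := bd_card hA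
  have hbk := bd_card hB
  have hApos : 0 < (bdF 𝓕 m k l A.card).card := card_pos.2 ⟨A, mem_bdF.2 ⟨hA, rfl⟩⟩
  have hBpos : 0 < (bdF 𝓕 m k l B.card).card := card_pos.2 ⟨B, mem_bdF.2 ⟨hB, rfl⟩⟩
  by_cases hne : A.card = B.card
  · rw [← hne] at hsum
    have hin := fun p hp => ineq_eq hm hlm hF h2 hs hmax hgen hsum hak (p := p) hp
    generalize A.card = a at *
    have hdc : ∑ p ∈ range l, ((bdF 𝓕 m k l a).filter (fun A => p ∉ A)).card =
        (bdF 𝓕 m k l a).card * (l - a) := by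
      have := sum_card_bipartiteAbove_eq_sum_card_bipartiteBelow
        (s := range l) (t := bdF 𝓕 m k l a) (fun p A => p ∉ A)
      unfold bipartiteAbove bipartiteBelow at this
      rw [this]
      apply sum_const_nat
      intro A hA
      have hA := mem_bdF.1 hA
      have e : (range l).filter (fun p => p ∉ A) = range l \ A := by
        ext; simp
      rw [e, card_sdiff_of_subset hA.1.1, card_range, hA.2]
    have hsm := sum_le_sum hin
    rw [← sum_mul, hdc, sum_const, card_range, smul_eq_mul] at hsm
    obtain ⟨c, rfl⟩ : ∃ c, k = a + 1 + c := ⟨k - (a + 1), by omega⟩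
    obtain ⟨N, rfl⟩ : ∃ N, m = l + 1 + N := ⟨m - (l + 1), by omega⟩
    have e1 : l + 1 + N - l = N + 1 := by omega
    have e2 : l + 1 + N - (l + 1) = N := by omega
    have e3 : a + 1 + c - a = c + 1 := by omega
    have e4 : a + 1 + c - (a + 1) = c := by omega
    rw [e1, e2, e3, e4] at hsm
    have hC : 0 < N.choose c := Nat.choose_pos (by omega)
    have hid := Nat.add_one_mul_choose_eq N c
    obtain ⟨r, rfl⟩ : ∃ r, a = r + 2 := ⟨a - 2, by omega⟩
    have hl : l = 2 * r + 3 := by omega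
    have e5 : l - (r + 2) = r + 1 := by omega
    rw [e5] at hsm
    set β := (bdF 𝓕 (l + 1 + N) (r + 2 + 1 + c) l (r + 2)).card
    have h6 : (β * N.choose c) * ((r + 1) * (N + 1)) ≤ (β * N.choose c) * (l * (c + 1)) := by
      calc (β * N.choose c) * ((r + 1) * (N + 1)) = β * (r + 1) * ((N + 1) * N.choose c) := by ring
        _ = (β * (r + 1) * (N + 1).choose (c + 1)) * (c + 1) := by rw [hid]; ring
        _ ≤ (l * (β * N.choose c)) * (c + 1) := Nat.mul_le_mul_right _ hsm
        _ = _ := by ring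
    have h7 := Nat.le_of_mul_le_mul_left h6 (Nat.mul_pos hApos hC)
    subst hl
    have h8 : r + 3 + 3 * c ≤ N := by omega
    nlinarith
  · have i1 := ineq_ne hm hlm hF h2 hs hmax hgen hsum hak hbk hne
    have i2 := ineq_ne hm hlm hF h2 hs hmax hgen (by omega) hbk hak (Ne.symm hne)
    generalize A.card = a at *
    generalize B.card = b at *
    obtain ⟨x, hx⟩ : ∃ x, k = a + 1 + x := ⟨k - (a + 1), by omega⟩
    obtain ⟨y, hy⟩ : ∃ y, k = b + 1 + y := ⟨k - (b + 1), by omega⟩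
    have e1 : k - a = x + 1 := by omega
    have e2 : k - (a + 1) = x := by omega
    have e3 : k - b = y + 1 := by omega
    have e4 : k - (b + 1) = y := by omega
    rw [e1, e4] at i1
    rw [e2, e3] at i2
    have hN : x + y + 1 < m - (l + 1) := by omega
    generalize m - (l + 1) = N at *
    have j1 := Nat.choose_succ_right_eq N x
    have j2 := Nat.choose_succ_right_eq N y
    have hCx : 0 < N.choose x := Nat.choose_pos (by omega)
    have hCy : 0 < N.choose y := Nat.choose_pos (by omega)
    generalize (bdF 𝓕 m k l a).card = α at *
    generalize (bdF 𝓕 m k l b).card = β at *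
    have hmul := Nat.mul_le_mul i1 i2
    have h6 : (α * β * N.choose x * N.choose y) * ((N - x) * (N - y)) ≤
        (α * β * N.choose x * N.choose y) * ((x + 1) * (y + 1)) := by
      calc (α * β * N.choose x * N.choose y) * ((N - x) * (N - y))
          = α * β * (N.choose x * (N - x)) * (N.choose y * (N - y)) := by ring
        _ = (α * N.choose (x + 1) * (β * N.choose (y + 1))) * ((x + 1) * (y + 1)) := by
            rw [← j1, ← j2]; ring
        _ ≤ (β * N.choose y * (α * N.choose x)) * ((x + 1) * (y + 1)) :=
            Nat.mul_le_mul_right _ hmul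
        _ = _ := by ring
    have h7 := Nat.le_of_mul_le_mul_left h6 (by positivity)
    have h8 : (y + 2) * (x + 2) ≤ (N - x) * (N - y) := Nat.mul_le_mul (by omega) (by omega)
    nlinarith

end main

theorem ekr (m k : ℕ) (hk : 2 ≤ k) (hm3 : 3 * k ≤ m + 2) (𝓖 : Finset (Finset ℕ))
    (hG : 𝓖 ⊆ powersetCard k (range m)) (hG2 : TwoInt 𝓖) :
    𝓖.card ≤ (m - 2).choose (k - 2) := by
  classical
  obtain ⟨𝓕, hF, h2, hs, hmax⟩ := exists_stable m k
  refine (hmax 𝓖 hG hG2).trans ?_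
  have hm : 2 * k ≤ m := by omega
  have hex : ∃ p, ∀ F ∈ 𝓕, Full 𝓕 m k (F ∩ range p) := by
    refine ⟨m, fun F hFF => ?_⟩
    have h3 := mem_powersetCard.1 (hF hFF)
    rw [inter_eq_left.2 h3.1]
    refine ⟨h3.1, h3.2.le, fun B hB hBk hFB => ?_⟩
    rwa [← eq_of_subset_of_card_le hFB (by omega)]
  have hspec := Nat.find_spec hex
  have hmin := fun q => Nat.find_min (H := hex) (m := q)
  have hpm : Nat.find hex ≤ m := by
    apply Nat.find_min'
    intro F hFF
    have h3 := mem_powersetCard.1 (hF hFF)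
    rw [inter_eq_left.2 h3.1]
    refine ⟨h3.1, h3.2.le, fun B hB hBk hFB => ?_⟩
    rwa [← eq_of_subset_of_card_le hFB (by omega)]
  generalize Nat.find hex = p at *
  have hp2 : p ≤ 2 := by
    by_contra hp
    obtain ⟨l, rfl⟩ : ∃ l, p = l + 1 := ⟨p - 1, by omega⟩
    apply hmin l (by omega)
    intro F hFF
    by_contra hfu
    exact no_bd hk hm3 (by omega) hpm hF h2 hs hmax hspec _ (trace_bd hspec hFF hfu).2
  have hc := card_cyl m k 2 2 (by omega) hk {range 2} (by simp)
  rw [card_singleton, one_mul] at hc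
  rw [← hc]
  apply card_le_card
  intro F hFF
  refine mem_filter.2 ⟨hF hFF, mem_singleton.2 ?_⟩
  have h3 := full_inter hm h2 (hspec F hFF) (hspec F hFF)
  rw [inter_self] at h3
  have h4 : F ∩ range p ⊆ F ∩ range 2 := inter_subset_inter (Subset.refl _) (range_subset_range.2 hp2)
  apply eq_of_subset_of_card_le inter_subset_right
  rw [card_range]
  exact h3.trans (card_le_card h4)

lemma list_shift (l : List ℕ) (x : ℕ) : ∀ c, (∀ y ∈ l, c ≤ y) → l.Pairwise (· ≤ ·) → x ∈ l →
    ∀ i, (c :: l.erase x).getD i 0 ≤ l.getD i 0 := by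
  induction l with
  | nil => intro c _ _ hx; simp at hx
  | cons b l ih =>
    intro c hc hp hx i
    rw [List.pairwise_cons] at hp
    have hcb : c ≤ b := hc b (by simp)
    by_cases hbx : b = x
    · subst hbx
      rw [List.erase_cons_head]
      cases i with
      | zero => simpa using hcb
      | succ i => simp
    · rw [List.erase_cons_tail (by simpa using hbx)]
      cases i with
      | zero => simpa using hcb
      | succ i =>
        have hx' : x ∈ l := by
          rcases List.mem_cons.1 hx with h | h
          · exact absurd h.symm hbx
          · exact h
        have := ih b hp.1 hp.2 hx' i
        simpa using this

lemma shiftLE_one (A : Finset ℕ) (x : ℕ) (hx : x ∈ A) (h1 : 1 ∉ A) (hpos : ∀ y ∈ A, 1 ≤ y) :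
    ShiftLE (insert 1 (A.erase x)) A := by
  have h1' : 1 ∉ A.erase x := by simp [h1]
  refine ⟨?_, ?_⟩
  · rw [card_insert_of_notMem h1', card_erase_of_mem hx]
    have : 0 < A.card := card_pos.2 ⟨x, hx⟩
    omega
  · have e1 : (insert 1 (A.erase x)).sort (· ≤ ·) = 1 :: (A.erase x).sort (· ≤ ·) :=
      sort_insert (· ≤ ·) (fun b hb => hpos b (mem_of_mem_erase hb)) h1'
    have e2 : (A.erase x).sort (· ≤ ·) = (A.sort (· ≤ ·)).erase x := by
      apply List.Perm.eq_of_pairwise (le := (· ≤ ·))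
      · intro a b _ _ h h'; exact le_antisymm h h'
      · exact pairwise_sort _ _
      · exact (pairwise_sort A (· ≤ ·)).sublist List.erase_sublist
      · rw [List.perm_ext_iff_of_nodup (sort_nodup _ _) ((sort_nodup A (· ≤ ·)).erase x)]
        intro y
        rw [(sort_nodup A (· ≤ ·)).mem_erase_iff]
        simp
    rw [e1, e2]
    exact list_shift _ x 1 (fun y hy => hpos y (by simpa using hy)) (pairwise_sort _ _)
      (by simpa using hx)

end EKR2

theorem stmt_2 (n k : ℕ) (hk : 2 ≤ k) (hn : 3 * k - 2 < n) (𝓕 : Finset (Finset ℕ))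
    (hU : ∀ F ∈ 𝓕, F ⊆ Finset.Icc 1 n ∧ F.card = k)
    (hint : ∀ F ∈ 𝓕, ∀ F' ∈ 𝓕, (F ∩ F').Nonempty)
    (init : InitialFamily n 𝓕) :
    (𝓕.filter (fun F => 1 ∉ F)).card ≤ (n - 3).choose (k - 2) := by
  classical
  have hel : ∀ F ∈ 𝓕.filter (fun F => 1 ∉ F), ∀ x ∈ F, 2 ≤ x ∧ x ≤ n := by
    intro F hF x hx
    rw [Finset.mem_filter] at hF
    have h1 := Finset.mem_Icc.1 ((hU F hF.1).1 hx)
    have : x ≠ 1 := by rintro rfl; exact hF.2 hx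
    omega
  have h2 : EKR2.TwoInt (𝓕.filter (fun F => 1 ∉ F)) := by
    intro A hA B hB
    have hA' := Finset.mem_filter.1 hA
    have hB' := Finset.mem_filter.1 hB
    by_contra hcon
    obtain ⟨x, hx⟩ := hint A hA'.1 B hB'.1
    have hxA := (Finset.mem_inter.1 hx).1
    have hmem : insert 1 (A.erase x) ∈ 𝓕 := by
      apply init _ A _ (EKR2.shiftLE_one A x hxA hA'.2 (fun y hy => by have := hel A hA y hy; omega))
        hA'.1
      intro y hy
      rcases Finset.mem_insert.1 hy with rfl | hy
      · simp; omega
      · exact (hU A hA'.1).1 (Finset.mem_of_mem_erase hy)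
    obtain ⟨y, hy⟩ := hint _ hmem B hB'.1
    rw [Finset.mem_inter, Finset.mem_insert, Finset.mem_erase] at hy
    rcases hy with ⟨rfl | ⟨hyx, hyA⟩, hyB⟩
    · exact hB'.2 hyB
    · have hle : (A ∩ B).card ≤ 1 := by omega
      exact hyx (Finset.card_le_one.1 hle y (Finset.mem_inter.2 ⟨hyA, hyB⟩) x hx)
  have hinjA : ∀ F : Finset ℕ, (∀ x ∈ F, 2 ≤ x ∧ x ≤ n) →
      (F.image (fun x => x - 2)).image (fun x => x + 2) = F := by
    intro F hF
    rw [Finset.image_image]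
    conv_rhs => rw [← Finset.image_id (s := F)]
    apply Finset.image_congr
    intro x hx
    have := hF x hx
    simp; omega
  have hinj : Set.InjOn (fun F : Finset ℕ => F.image (fun x => x - 2))
      (𝓕.filter (fun F => 1 ∉ F) : Finset (Finset ℕ)) := by
    intro A hA B hB hAB
    rw [← hinjA A (hel A hA), ← hinjA B (hel B hB)]
    exact congrArg _ hAB
  have hsub : ∀ F : Finset ℕ, (∀ x ∈ F, 2 ≤ x ∧ x ≤ n) →
      Set.InjOn (fun x => x - 2) (F : Set ℕ) := by
    intro F hF x hx y hy hxy
    have := hF x hx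
    have := hF y hy
    simp only at hxy
    omega
  rw [← Finset.card_image_of_injOn hinj]
  have := EKR2.ekr (n - 1) k hk (by omega)
    ((𝓕.filter (fun F => 1 ∉ F)).image (fun F : Finset ℕ => F.image (fun x => x - 2))) (by
      intro G hG
      obtain ⟨F, hF, rfl⟩ := Finset.mem_image.1 hG
      rw [Finset.mem_powersetCard, Finset.card_image_of_injOn (hsub F (hel F hF))]
      refine ⟨?_, (hU F (Finset.mem_filter.1 hF).1).2⟩
      intro y hy
      obtain ⟨x, hx, rfl⟩ := Finset.mem_image.1 hy
      have := hel F hF x hx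
      simp; omega) (by
      intro G hG H hH
      obtain ⟨A, hA, rfl⟩ := Finset.mem_image.1 hG
      obtain ⟨B, hB, rfl⟩ := Finset.mem_image.1 hH
      have h3 := h2 A hA B hB
      have h4 : ((A ∩ B).image (fun x => x - 2)).card = (A ∩ B).card :=
        Finset.card_image_of_injOn (hsub _ (fun x hx => hel A hA x (Finset.mem_inter.1 hx).1))
      rw [← h4] at h3
      exact h3.trans (Finset.card_le_card (Finset.image_inter_subset _ _ _)))
  have e : n - 1 - 2 = n - 3 := by omega
  rwa [e] at this
end

section
/- Suppose F ⊂ binom([n], k) is an intersecting family with n ≥ 2k and |F| ≥ 36·C(n-3, k-3). Then ρ(F) > 1/2, i.e., there exists an element i with |{F ∈ F : i ∈ F}| > |F|/2. -/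
open Classical in
/-- number of members of a family with a given property -/
noncomputable def cnt (𝓕 : Finset (Finset ℕ)) (Q : Finset ℕ → Prop) : ℕ := (𝓕.filter Q).card

theorem cnt_mono {𝓕 : Finset (Finset ℕ)} {Q Q' : Finset ℕ → Prop}
    (h : ∀ F ∈ 𝓕, Q F → Q' F) : cnt 𝓕 Q ≤ cnt 𝓕 Q' := by
  classical
  unfold cnt
  apply Finset.card_le_card
  intro F hF
  rw [Finset.mem_filter] at *
  exact ⟨hF.1, h F hF.1 hF.2⟩

theorem cnt_congr {𝓕 : Finset (Finset ℕ)} {Q Q' : Finset ℕ → Prop}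
    (h : ∀ F ∈ 𝓕, Q F ↔ Q' F) : cnt 𝓕 Q = cnt 𝓕 Q' :=
  le_antisymm (cnt_mono fun F hF => (h F hF).1) (cnt_mono fun F hF => (h F hF).2)

theorem cnt_add {𝓕 : Finset (Finset ℕ)} {Q Q1 Q2 : Finset ℕ → Prop}
    (h : ∀ F ∈ 𝓕, Q F → Q1 F ∨ Q2 F) : cnt 𝓕 Q ≤ cnt 𝓕 Q1 + cnt 𝓕 Q2 := by
  classical
  unfold cnt
  refine le_trans (Finset.card_le_card ?_) (Finset.card_union_le _ _)
  intro F hF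
  rw [Finset.mem_union, Finset.mem_filter, Finset.mem_filter]
  rw [Finset.mem_filter] at hF
  rcases h F hF.1 hF.2 with h' | h'
  · exact Or.inl ⟨hF.1, h'⟩
  · exact Or.inr ⟨hF.1, h'⟩

theorem cnt_compl (𝓕 : Finset (Finset ℕ)) (Q : Finset ℕ → Prop) :
    cnt 𝓕 Q + cnt 𝓕 (fun F => ¬ Q F) = 𝓕.card := by
  classical
  unfold cnt
  convert Finset.card_filter_add_card_filter_not (s := 𝓕) Q

theorem cnt_true (𝓕 : Finset (Finset ℕ)) : cnt 𝓕 (fun _ => True) = 𝓕.card := by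
  classical
  unfold cnt
  simp

/-- `k`-uniform intersecting families on `[n]` -/
def Good (n k : ℕ) (𝓕 : Finset (Finset ℕ)) : Prop :=
  (∀ F ∈ 𝓕, F ⊆ Finset.Icc 1 n ∧ F.card = k) ∧ (∀ F ∈ 𝓕, ∀ F' ∈ 𝓕, (F ∩ F').Nonempty)

/-- replace `b` by `a` -/
def sw (a b : ℕ) (F : Finset ℕ) : Finset ℕ := insert a (F.erase b)

def shf (a b : ℕ) (𝓕 : Finset (Finset ℕ)) (F : Finset ℕ) : Finset ℕ :=
  if b ∈ F ∧ a ∉ F ∧ sw a b F ∉ 𝓕 then sw a b F else F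

/-- the shift -/
def sh (a b : ℕ) (𝓕 : Finset (Finset ℕ)) : Finset (Finset ℕ) := 𝓕.image (shf a b 𝓕)

def Shifted (U : Finset ℕ) (𝓕 : Finset (Finset ℕ)) : Prop :=
  ∀ F ∈ 𝓕, ∀ a ∈ U, ∀ b ∈ U, a < b → b ∈ F → a ∉ F → sw a b F ∈ 𝓕

theorem sw_inj {a b : ℕ} {F G : Finset ℕ} (hF : b ∈ F) (hF' : a ∉ F) (hG : b ∈ G) (hG' : a ∉ G)
    (h : sw a b F = sw a b G) : F = G := by
  ext x
  have := Finset.ext_iff.1 h x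
  simp only [sw, Finset.mem_insert, Finset.mem_erase] at this
  by_cases h1 : x = a
  · subst h1; tauto
  · by_cases h2 : x = b
    · subst h2; tauto
    · tauto

theorem shf_injOn (a b : ℕ) (𝓕 : Finset (Finset ℕ)) : Set.InjOn (shf a b 𝓕) (𝓕 : Set (Finset ℕ)) := by
  intro F hF G hG h
  rw [Finset.mem_coe] at hF hG
  unfold shf at h
  split_ifs at h with h1 h2 h2
  · exact sw_inj h1.1 h1.2.1 h2.1 h2.2.1 h
  · exact absurd (h ▸ hG) h1.2.2
  · exact absurd (h ▸ hF) h2.2.2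
  · exact h

theorem cnt_sh {a b : ℕ} {𝓕 : Finset (Finset ℕ)} {Q : Finset ℕ → Prop}
    (hQ : ∀ F, b ∈ F → a ∉ F → (Q (sw a b F) ↔ Q F)) : cnt (sh a b 𝓕) Q = cnt 𝓕 Q := by
  classical
  unfold cnt sh
  rw [Finset.filter_image, Finset.card_image_of_injOn]
  · congr 1
    apply Finset.filter_congr
    intro F hF
    unfold shf
    split_ifs with h
    · exact hQ F h.1 h.2.1
    · rfl
  · exact (shf_injOn a b 𝓕).mono (by intro x hx; simp at hx ⊢; exact hx.1)

theorem mem_sh_of_mem {a b : ℕ} {𝓕 : Finset (Finset ℕ)} (hab : a ≠ b) {G : Finset ℕ} (hG : G ∈ sh a b 𝓕)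
    (hb : b ∈ G) : G ∈ 𝓕 := by
  unfold sh at hG
  rw [Finset.mem_image] at hG
  obtain ⟨F, hF, rfl⟩ := hG
  unfold shf at *
  split_ifs at * with h
  · simp [sw, hab.symm] at hb
  · exact hF

theorem mem_sh {a b : ℕ} {𝓕 : Finset (Finset ℕ)} {G : Finset ℕ} (hG : G ∈ sh a b 𝓕) :
    (G ∈ 𝓕 ∧ (b ∈ G → a ∉ G → sw a b G ∈ 𝓕)) ∨
      ∃ F ∈ 𝓕, b ∈ F ∧ a ∉ F ∧ G = sw a b F := by
  unfold sh at hG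
  rw [Finset.mem_image] at hG
  obtain ⟨F, hF, rfl⟩ := hG
  unfold shf at *
  split_ifs at * with h
  · exact Or.inr ⟨F, hF, h.1, h.2.1, rfl⟩
  · refine Or.inl ⟨hF, fun h1 h2 => ?_⟩
    by_contra h3
    exact h ⟨h1, h2, h3⟩

theorem sw_card {a b : ℕ} {F : Finset ℕ} (hb : b ∈ F) (ha : a ∉ F) : (sw a b F).card = F.card := by
  unfold sw
  rw [Finset.card_insert_of_notMem (by simp [ha]), Finset.card_erase_of_mem hb]
  have := Finset.card_pos.2 ⟨b, hb⟩
  omega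

theorem inter_aux {a b : ℕ} (hab : a ≠ b) {𝓕 : Finset (Finset ℕ)}
    (h : ∀ F ∈ 𝓕, ∀ F' ∈ 𝓕, (F ∩ F').Nonempty) {F G : Finset ℕ} (hF : F ∈ 𝓕) (hb : b ∈ F) (ha : a ∉ F)
    (hG : G ∈ 𝓕) (hG' : b ∈ G → a ∉ G → sw a b G ∈ 𝓕) : (sw a b F ∩ G).Nonempty := by
  by_cases haG : a ∈ G
  · exact ⟨a, by simp [sw, haG]⟩
  by_cases hbG : b ∈ G
  · obtain ⟨x, hx⟩ := h F hF _ (hG' hbG haG)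
    simp only [sw, Finset.mem_inter, Finset.mem_insert, Finset.mem_erase] at hx
    refine ⟨x, ?_⟩
    simp only [sw, Finset.mem_inter, Finset.mem_insert, Finset.mem_erase]
    rcases hx with ⟨h1, rfl | h2⟩
    · exact absurd h1 ha
    · tauto
  · obtain ⟨x, hx⟩ := h F hF _ hG
    simp only [Finset.mem_inter] at hx
    refine ⟨x, ?_⟩
    simp only [sw, Finset.mem_inter, Finset.mem_insert, Finset.mem_erase]
    have : x ≠ b := by rintro rfl; exact hbG hx.2
    tauto

theorem Good.sh {n k a b : ℕ} {𝓕 : Finset (Finset ℕ)} (h : Good n k 𝓕) (hab : a ≠ b)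
    (ha : a ∈ Finset.Icc 1 n) : Good n k (sh a b 𝓕) := by
  constructor
  · intro G hG
    rcases mem_sh hG with h1 | ⟨F, hF, h1, h2, rfl⟩
    · exact h.1 G h1.1
    · refine ⟨?_, (sw_card h1 h2).trans (h.1 F hF).2⟩
      unfold sw
      intro x hx
      rw [Finset.mem_insert, Finset.mem_erase] at hx
      rcases hx with rfl | hx
      · exact ha
      · exact (h.1 F hF).1 hx.2
  · intro F hF G hG
    rcases mem_sh hF with h1 | ⟨F, hF1, h1, h2, rfl⟩ <;>
      rcases mem_sh hG with h1' | ⟨G, hG1, h1', h2', rfl⟩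
    · exact h.2 _ h1.1 _ h1'.1
    · rw [Finset.inter_comm]
      exact inter_aux hab h.2 hG1 h1' h2' h1.1 h1.2
    · exact inter_aux hab h.2 hF1 h1 h2 h1'.1 h1'.2
    · exact ⟨a, by simp [sw]⟩

theorem sw_sum {a b : ℕ} (hab : a < b) {F : Finset ℕ} (hb : b ∈ F) (ha : a ∉ F) :
    ∑ x ∈ sw a b F, x < ∑ x ∈ F, x := by
  unfold sw
  rw [Finset.sum_insert (by simp [ha]), ← Finset.add_sum_erase F (fun x => x) hb]
  omega

theorem sum_sh {a b : ℕ} (hab : a < b) {𝓕 : Finset (Finset ℕ)} {F : Finset ℕ} (hF : F ∈ 𝓕) (hb : b ∈ F)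
    (ha : a ∉ F) (hs : sw a b F ∉ 𝓕) : ∑ G ∈ sh a b 𝓕, ∑ x ∈ G, x < ∑ G ∈ 𝓕, ∑ x ∈ G, x := by
  unfold sh
  rw [Finset.sum_image (shf_injOn a b 𝓕)]
  apply Finset.sum_lt_sum
  · intro G hG
    unfold shf
    split_ifs with h
    · exact (sw_sum hab h.1 h.2.1).le
    · exact le_rfl
  · refine ⟨F, hF, ?_⟩
    unfold shf
    rw [if_pos ⟨hb, ha, hs⟩]
    exact sw_sum hab hb ha

theorem driver {n k : ℕ} (P : Finset (Finset ℕ) → Prop) (W : Finset ℕ) (N : ℕ) :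
    ∀ 𝓕 : Finset (Finset ℕ), ∑ G ∈ 𝓕, ∑ x ∈ G, x ≤ N → Good n k 𝓕 → P 𝓕 →
    ∃ 𝓖, Good n k 𝓖 ∧ P 𝓖 ∧
      (∀ Q : Finset ℕ → Prop, (∀ F, Q F ↔ Q (F ∩ W)) → cnt 𝓖 Q = cnt 𝓕 Q) ∧
      (Shifted (Finset.Icc 1 n \ W) 𝓖 ∨ ∃ a b, a < b ∧ a ∈ Finset.Icc 1 n \ W ∧
        b ∈ Finset.Icc 1 n \ W ∧ ¬ P (sh a b 𝓖)) := by
  induction N with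
  | zero =>
    intro 𝓕 hN hG hP
    refine ⟨𝓕, hG, hP, fun _ _ => rfl, Or.inl ?_⟩
    intro F hF a ha b hb hab hbF haF
    by_contra hs
    have := sum_sh hab hF hbF haF hs
    omega
  | succ N ih =>
    intro 𝓕 hN hG hP
    by_cases hS : Shifted (Finset.Icc 1 n \ W) 𝓕
    · exact ⟨𝓕, hG, hP, fun _ _ => rfl, Or.inl hS⟩
    unfold Shifted at hS
    push Not at hS
    obtain ⟨F, hF, a, ha, b, hb, hab, hbF, haF, hs⟩ := hS
    by_cases hP' : P (sh a b 𝓕)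
    · have hlt := sum_sh hab hF hbF haF hs
      obtain ⟨𝓖, h1, h2, h3, h4⟩ := ih (sh a b 𝓕) (by omega)
        (hG.sh hab.ne (Finset.mem_sdiff.1 ha).1) hP'
      refine ⟨𝓖, h1, h2, ?_, h4⟩
      intro Q hQ
      rw [h3 Q hQ, cnt_sh]
      intro F hbF haF
      rw [hQ, hQ F]
      have : sw a b F ∩ W = F ∩ W := by
        ext x
        simp only [sw, Finset.mem_inter, Finset.mem_insert, Finset.mem_erase]
        have h1 : x ∈ W → x ≠ a := by rintro h rfl; exact (Finset.mem_sdiff.1 ha).2 h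
        have h2 : x ∈ W → x ≠ b := by rintro h rfl; exact (Finset.mem_sdiff.1 hb).2 h
        tauto
      rw [this]
    · exact ⟨𝓕, hG, hP, fun _ _ => rfl, Or.inr ⟨a, b, hab, ha, hb, hP'⟩⟩

/-- the walk of `F` on `U` reaches height `t` -/
def hit (U : Finset ℕ) (t : ℕ) (F : Finset ℕ) : Prop :=
  ∃ m, (U.filter (· ≤ m)).card + t ≤ 2 * ((F ∩ U).filter (· ≤ m)).card

theorem filt_erase {U : Finset ℕ} {u m : ℕ} (hu : u ∈ U) (hm : u ≤ m) :
    (U.filter (· ≤ m)).card = ((U.erase u).filter (· ≤ m)).card + 1 := by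
  rw [Finset.filter_erase, Finset.card_erase_of_mem (by simp [hu, hm])]
  have : 0 < (U.filter (· ≤ m)).card := Finset.card_pos.2 ⟨u, by simp [hu, hm]⟩
  omega

theorem filt_empty {U : Finset ℕ} {u m : ℕ} (hu : ∀ y ∈ U, u ≤ y) (hm : ¬ u ≤ m) :
    U.filter (· ≤ m) = ∅ := by
  rw [Finset.filter_eq_empty_iff]
  intro x hx
  have := hu x hx
  omega

theorem hit_erase {U F : Finset ℕ} {u t : ℕ} (hu : u ∈ U) (hmin : ∀ y ∈ U, u ≤ y) (huF : u ∉ F)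
    (h : hit U (t + 1) F) : hit (U.erase u) (t + 2) F := by
  obtain ⟨m, hm⟩ := h
  have e : F ∩ U.erase u = F ∩ U := by
    rw [Finset.inter_erase, Finset.erase_eq_of_notMem (by simp [huF])]
  refine ⟨m, ?_⟩
  by_cases hum : u ≤ m
  · rw [filt_erase hu hum] at hm
    rw [e]; omega
  · rw [filt_empty (U := F ∩ U) (fun y hy => hmin y (Finset.mem_inter.1 hy).2) hum] at hm
    simp at hm

theorem hit_erase' {U F : Finset ℕ} {u t : ℕ} (hu : u ∈ U) (hmin : ∀ y ∈ U, u ≤ y) (huF : u ∈ F)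
    (h : hit U (t + 1) F) : hit (U.erase u) t (F.erase u) := by
  obtain ⟨m, hm⟩ := h
  have e : F.erase u ∩ U.erase u = (F ∩ U).erase u := by
    ext x; simp only [Finset.mem_inter, Finset.mem_erase]; tauto
  refine ⟨m, ?_⟩
  by_cases hum : u ≤ m
  · rw [filt_erase hu hum, filt_erase (U := F ∩ U) (by simp [hu, huF]) hum] at hm
    rw [e]; omega
  · rw [filt_empty (U := F ∩ U) (fun y hy => hmin y (Finset.mem_inter.1 hy).2) hum] at hm
    simp at hm

def cb (N l t : ℕ) : ℕ := if t ≤ l then N.choose (l - t) else 0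

theorem cb_rec (N l t : ℕ) : cb N l t + cb N (l + 1) (t + 2) ≤ cb (N + 1) (l + 1) (t + 1) := by
  unfold cb
  by_cases h : t ≤ l
  · obtain ⟨j, rfl⟩ := Nat.exists_eq_add_of_le h
    rw [if_pos h, if_pos (by omega : t + 1 ≤ t + j + 1)]
    have e1 : t + j - t = j := by omega
    have e2 : t + j + 1 - (t + 1) = j := by omega
    rw [e1, e2]
    cases j with
    | zero => rw [if_neg (by omega)]; simp
    | succ j =>
      rw [if_pos (by omega)]
      have e3 : t + (j + 1) + 1 - (t + 2) = j := by omega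
      rw [e3, Nat.choose_succ_succ']; omega
  · rw [if_neg h, if_neg (by omega)]; simp

open Classical in
theorem hit_count (U : Finset ℕ) : ∀ t l : ℕ,
    ((U.powersetCard l).filter (hit U t)).card ≤ cb U.card l t := by
  induction U using Finset.induction_on_min with
  | empty =>
    intro t l
    cases t with
    | zero =>
      refine (Finset.card_filter_le _ _).trans ?_
      simp [cb]
    | succ t =>
      have : (Finset.powersetCard l (∅ : Finset ℕ)).filter (hit ∅ (t + 1)) = ∅ := by
        rw [Finset.filter_eq_empty_iff]
        rintro F hF ⟨m, hm⟩
        simp at hm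
      rw [this]; simp
  | insert a s has ih =>
    intro t l
    have ha : a ∉ s := fun h => lt_irrefl _ (has a h)
    have hmin : ∀ y ∈ insert a s, a ≤ y := by
      intro y hy
      rcases Finset.mem_insert.1 hy with rfl | h
      · exact le_rfl
      · exact (has y h).le
    have hes : (insert a s).erase a = s := Finset.erase_insert ha
    cases t with
    | zero =>
      refine (Finset.card_filter_le _ _).trans ?_
      simp [cb]
    | succ t =>
      rw [Finset.card_insert_of_notMem ha]
      have h2 : (((Finset.powersetCard l (insert a s)).filter (hit (insert a s) (t + 1))).filter
          (fun F => ¬ a ∈ F)).card ≤ cb s.card l (t + 2) := by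
        refine le_trans (Finset.card_le_card ?_) (ih (t + 2) l)
        intro F hF
        simp only [Finset.mem_filter, Finset.mem_powersetCard] at hF ⊢
        obtain ⟨⟨⟨h1, h2⟩, h3⟩, h4⟩ := hF
        have h5 := hit_erase (Finset.mem_insert_self a s) hmin h4 h3
        rw [hes] at h5
        exact ⟨⟨(Finset.subset_insert_iff_of_notMem h4).1 h1, h2⟩, h5⟩
      rw [← Finset.card_filter_add_card_filter_not (fun F => a ∈ F)]
      cases l with
      | zero =>
        have h1 : (((Finset.powersetCard 0 (insert a s)).filter (hit (insert a s) (t + 1))).filter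
          (fun F => a ∈ F)) = ∅ := by
          rw [Finset.filter_eq_empty_iff]
          intro F hF
          simp only [Finset.mem_filter, Finset.mem_powersetCard, Finset.card_eq_zero] at hF
          rw [hF.1.2]; simp
        rw [h1]
        refine le_trans (Nat.add_le_add_left h2 _) ?_
        simp [cb]
      | succ l =>
        have h1 : (((Finset.powersetCard (l+1) (insert a s)).filter (hit (insert a s) (t + 1))).filter
          (fun F => a ∈ F)).card ≤ cb s.card l t := by
          refine le_trans ?_ (ih t l)
          apply Finset.card_le_card_of_injOn (fun F => F.erase a)
          · intro F hF
            simp only [Finset.coe_filter, Finset.mem_filter, Finset.mem_powersetCard,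
              Set.mem_ofPred_eq] at hF ⊢
            obtain ⟨⟨⟨h1, h2⟩, h3⟩, h4⟩ := hF
            have h5 := hit_erase' (Finset.mem_insert_self a s) hmin h4 h3
            rw [hes] at h5
            refine ⟨⟨Finset.subset_insert_iff.1 h1, ?_⟩, h5⟩
            rw [Finset.card_erase_of_mem h4, h2]; simp
          · intro F hF G hG h
            simp only [Finset.coe_filter, Finset.mem_filter, Set.mem_ofPred_eq] at hF hG
            simp only at h
            rw [← Finset.insert_erase hF.2, ← Finset.insert_erase hG.2, h]
        exact (Nat.add_le_add h1 h2).trans (cb_rec _ _ _)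

theorem trace_count {n k t : ℕ} {𝓕 : Finset (Finset ℕ)} (hG : Good n k 𝓕) {W S : Finset ℕ}
    (hW : W ⊆ Finset.Icc 1 n) {Q : Finset ℕ → Prop}
    (hQ : ∀ F ∈ 𝓕, Q F → F ∩ W = S ∧ hit (Finset.Icc 1 n \ W) t F) :
    cnt 𝓕 Q ≤ (n - W.card).choose (k - S.card - t) := by
  classical
  have hc : (Finset.Icc 1 n \ W).card = n - W.card := by
    rw [Finset.card_sdiff_of_subset hW]; simp
  have h1 := hit_count (Finset.Icc 1 n \ W) t (k - S.card)
  have h2 : cb (Finset.Icc 1 n \ W).card (k - S.card) t ≤ (n - W.card).choose (k - S.card - t) := by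
    unfold cb
    rw [hc]
    split_ifs <;> simp
  refine le_trans ?_ (h1.trans h2)
  unfold cnt
  have hd : ∀ F : Finset ℕ, F ∩ W ∪ F \ W = F := fun F => by
    ext x; simp only [Finset.mem_union, Finset.mem_inter, Finset.mem_sdiff]; tauto
  apply Finset.card_le_card_of_injOn (fun F => F \ W)
  · intro F hF
    simp only [Finset.coe_filter, Finset.mem_powersetCard, Set.mem_ofPred_eq] at hF ⊢
    obtain ⟨q1, q2⟩ := hQ F hF.1 hF.2
    obtain ⟨g1, g2⟩ := hG.1 F hF.1
    refine ⟨⟨Finset.sdiff_subset_sdiff g1 le_rfl, ?_⟩, ?_⟩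
    · have := Finset.card_sdiff_add_card_inter F W
      rw [q1] at this
      omega
    · obtain ⟨m, hm⟩ := q2
      refine ⟨m, ?_⟩
      have : F \ W ∩ (Finset.Icc 1 n \ W) = F ∩ (Finset.Icc 1 n \ W) := by
        ext x; simp only [Finset.mem_inter, Finset.mem_sdiff]; tauto
      rw [this]; exact hm
  · intro F hF G hG' h
    simp only [Finset.coe_filter, Set.mem_ofPred_eq] at hF hG' h
    rw [← hd F, ← hd G, (hQ F hF.1 hF.2).1, (hQ G hG'.1 hG'.2).1, h]

theorem core {n k : ℕ} {𝓕 : Finset (Finset ℕ)} (hG : Good n k 𝓕) {W : Finset ℕ}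
    (hS : Shifted (Finset.Icc 1 n \ W) 𝓕) {G : Finset ℕ} (hGm : G ∈ 𝓕) (r : ℕ) : ∀ F ∈ 𝓕,
    (F ∩ G).card = r → F ∩ G ∩ W = ∅ →
    ∃ m, ((Finset.Icc 1 n \ W).filter (· ≤ m)).card + 1 ≤
      ((F ∩ (Finset.Icc 1 n \ W)).filter (· ≤ m)).card +
      ((G ∩ (Finset.Icc 1 n \ W)).filter (· ≤ m)).card := by
  set U := Finset.Icc 1 n \ W with hU
  induction r with
  | zero =>
    intro F hF h0 _
    have := hG.2 F hF G hGm
    rw [← Finset.card_pos] at this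
    omega
  | succ r ih =>
    intro F hF hr hW
    by_contra! hcon
    have hne := hG.2 F hF G hGm
    set x := (F ∩ G).min' hne with hx
    have hxm : x ∈ F ∩ G := Finset.min'_mem _ _
    have hxmin : ∀ y ∈ F ∩ G, x ≤ y := fun y hy => Finset.min'_le _ _ hy
    obtain ⟨hxF, hxG⟩ := Finset.mem_inter.1 hxm
    have hxW : x ∉ W := fun h => by
      have : x ∈ F ∩ G ∩ W := Finset.mem_inter.2 ⟨hxm, h⟩
      rw [hW] at this; simp at this
    have hxU : x ∈ U := Finset.mem_sdiff.2 ⟨(hG.1 F hF).1 hxF, hxW⟩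
    -- find y
    have hy : ∃ y ∈ U, y ≤ x ∧ y ∉ F ∧ y ∉ G := by
      by_contra! hno
      have h1 := hcon x
      have h2 := Finset.card_union_add_card_inter ((F ∩ U).filter (· ≤ x)) ((G ∩ U).filter (· ≤ x))
      have h3 : U.filter (· ≤ x) ⊆ ((F ∩ U).filter (· ≤ x)) ∪ ((G ∩ U).filter (· ≤ x)) := by
        intro y hy
        simp only [Finset.mem_union, Finset.mem_filter, Finset.mem_inter] at hy ⊢
        have := hno y hy.1 hy.2
        tauto
      have h4 := Finset.card_le_card h3
      have h5 : 0 < (((F ∩ U).filter (· ≤ x)) ∩ ((G ∩ U).filter (· ≤ x))).card :=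
        Finset.card_pos.2 ⟨x, by simp [hxF, hxG, hxU]⟩
      omega
    obtain ⟨y, hyU, hyx, hyF, hyG⟩ := hy
    have hyx' : y < x := lt_of_le_of_ne hyx (by rintro h; exact hyF (h ▸ hxF))
    have hF' := hS F hF y hyU x hxU hyx' hxF hyF
    have hi : sw y x F ∩ G = (F ∩ G).erase x := by
      ext z
      simp only [sw, Finset.mem_inter, Finset.mem_insert, Finset.mem_erase]
      have : z ∈ G → z ≠ y := by rintro h rfl; exact hyG h
      tauto
    obtain ⟨m, hm⟩ := ih (sw y x F) hF' (by rw [hi, Finset.card_erase_of_mem hxm, hr]; rfl)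
      (by
        rw [hi]
        apply Finset.subset_empty.1
        rw [← hW]
        exact Finset.inter_subset_inter_right (Finset.erase_subset _ _))
    have hcm := hcon m
    have hsU : sw y x F ∩ U = insert y ((F ∩ U).erase x) := by
      ext z
      simp only [sw, Finset.mem_inter, Finset.mem_insert, Finset.mem_erase]
      have : z = y → z ∈ U := by rintro rfl; exact hyU
      tauto
    by_cases hxm' : x ≤ m
    · have h1 := filt_erase (U := F ∩ U) (u := x) (m := m) (by simp [hxF, hxU]) hxm'
      have h2 := filt_erase (U := insert y ((F ∩ U).erase x)) (u := y) (m := m)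
        (Finset.mem_insert_self _ _) (by omega)
      rw [Finset.erase_insert (by simp [hyF])] at h2
      rw [hsU] at hm
      omega
    · have h2 := Finset.card_union_add_card_inter ((sw y x F ∩ U).filter (· ≤ m))
        ((G ∩ U).filter (· ≤ m))
      have h3 : ((sw y x F ∩ U).filter (· ≤ m)) ∩ ((G ∩ U).filter (· ≤ m)) = ∅ := by
        apply Finset.eq_empty_of_forall_notMem
        intro z hz
        simp only [Finset.mem_inter, Finset.mem_filter] at hz
        have hz' : z ∈ sw y x F ∩ G := Finset.mem_inter.2 ⟨hz.1.1.1, hz.2.1.1⟩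
        rw [hi] at hz'
        have := hxmin z (Finset.mem_of_mem_erase hz')
        omega
      have h4 : ((sw y x F ∩ U).filter (· ≤ m)) ∪ ((G ∩ U).filter (· ≤ m)) ⊆ U.filter (· ≤ m) := by
        intro z hz
        simp only [Finset.mem_union, Finset.mem_inter, Finset.mem_filter] at hz ⊢
        tauto
      have h5 := Finset.card_le_card h4
      rw [h3, Finset.card_empty] at h2
      omega

theorem cnt_sub {𝓕 𝓖 : Finset (Finset ℕ)} {Q : Finset ℕ → Prop}
    (h : ∀ F ∈ 𝓖, Q F → F ∈ 𝓕) : cnt 𝓖 Q ≤ cnt 𝓕 Q := by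
  classical
  unfold cnt
  apply Finset.card_le_card
  intro F hF
  rw [Finset.mem_filter] at *
  exact ⟨h F hF.1 hF.2, hF.2⟩

theorem choose_bound {n k : ℕ} (hn : 2 * k ≤ n) (hn6 : 6 ≤ n) :
    (n - 2).choose (k - 3) ≤ 2 * (n - 3).choose (k - 3) := by
  obtain ⟨N, rfl⟩ : ∃ N, n = N + 3 := ⟨n - 3, by omega⟩
  have e1 : N + 3 - 2 = N + 1 := by omega
  have e2 : N + 3 - 3 = N := by omega
  rw [e1, e2]
  by_cases hk : k ≤ 3
  · have : k - 3 = 0 := by omega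
    rw [this]; simp
  · obtain ⟨K, rfl⟩ : ∃ K, k = K + 4 := ⟨k - 4, by omega⟩
    have e3 : K + 4 - 3 = K + 1 := by omega
    rw [e3, Nat.choose_succ_succ']
    have : N.choose K ≤ N.choose (K + 1) := Nat.choose_le_succ_of_lt_half_left (by omega)
    omega

theorem exists_min (U : Finset ℕ) (h : 0 < U.card) : ∃ u ∈ U, ∀ y ∈ U, u ≤ y :=
  ⟨U.min' (Finset.card_pos.1 h), Finset.min'_mem _ _, fun y hy => Finset.min'_le _ _ hy⟩

theorem hit_zero {n : ℕ} (W F : Finset ℕ) : hit (Finset.Icc 1 n \ W) 0 F := by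
  refine ⟨0, ?_⟩
  have : (Finset.Icc 1 n \ W).filter (· ≤ 0) = ∅ := by
    rw [Finset.filter_eq_empty_iff]
    intro x hx
    have := Finset.mem_Icc.1 (Finset.mem_sdiff.1 hx).1
    omega
  rw [this]; simp

theorem sdiff_ins (n : ℕ) (W : Finset ℕ) (u : ℕ) :
    (Finset.Icc 1 n \ W).erase u = Finset.Icc 1 n \ insert u W := by
  ext x; simp only [Finset.mem_erase, Finset.mem_sdiff, Finset.mem_insert]; tauto

theorem two_min {n k : ℕ} {𝓖 : Finset (Finset ℕ)} (hG : Good n k 𝓖) {W : Finset ℕ}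
    (hS : Shifted (Finset.Icc 1 n \ W) 𝓖) {u v : ℕ} (hu : u ∈ Finset.Icc 1 n \ W)
    (humin : ∀ y ∈ Finset.Icc 1 n \ W, u ≤ y) (hv : v ∈ Finset.Icc 1 n \ insert u W)
    (hvmin : ∀ y ∈ Finset.Icc 1 n \ insert u W, v ≤ y) {F : Finset ℕ} (hF : F ∈ 𝓖)
    (hFW : F ∩ W = ∅) (huF : u ∉ F) (hvF : v ∉ F) :
    hit (Finset.Icc 1 n \ insert v (insert u W)) 3 F := by
  have h1 : hit (Finset.Icc 1 n \ W) 1 F := by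
    obtain ⟨m, hm⟩ := core hG hS hF _ F hF rfl (by rw [Finset.inter_self, hFW])
    exact ⟨m, by omega⟩
  have h2 := hit_erase hu humin huF h1
  rw [sdiff_ins] at h2
  have h3 := hit_erase hv hvmin hvF h2
  rwa [sdiff_ins] at h3

theorem pair_lemma {n k : ℕ} (hn : 2 * k ≤ n) (hn6 : 6 ≤ n) {𝓕 : Finset (Finset ℕ)} (hG : Good n k 𝓕)
    {x y : ℕ} (hx : x ∈ Finset.Icc 1 n) (hy : y ∈ Finset.Icc 1 n) (hxy : x ≠ y)
    (hbig : 2 * (n - 3).choose (k - 3) < cnt 𝓕 (fun F => x ∈ F ∧ y ∈ F)) :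
    cnt 𝓕 (fun F => x ∉ F ∧ y ∉ F) ≤ 2 * (n - 3).choose (k - 3) := by
  obtain ⟨𝓖, hGG, -, htr, hS⟩ := driver (n := n) (k := k) (fun _ => True) {x, y} _ 𝓕 le_rfl hG trivial
  replace hS : Shifted (Finset.Icc 1 n \ {x, y}) 𝓖 := by
    rcases hS with h | ⟨a, b, _, _, _, h⟩
    · exact h
    · exact absurd trivial h
  rw [← htr _ (by intro F; simp)] at hbig ⊢
  have hWs : ({x, y} : Finset ℕ) ⊆ Finset.Icc 1 n := by
    intro z hz; simp only [Finset.mem_insert, Finset.mem_singleton] at hz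
    rcases hz with rfl | rfl <;> assumption
  have hWc : ({x, y} : Finset ℕ).card = 2 := Finset.card_pair hxy
  have hUc : (Finset.Icc 1 n \ {x, y}).card = n - 2 := by
    rw [Finset.card_sdiff_of_subset hWs, hWc]; simp
  obtain ⟨u, huU, humin⟩ := exists_min (Finset.Icc 1 n \ {x, y}) (by omega)
  have huW : u ∉ ({x, y} : Finset ℕ) := (Finset.mem_sdiff.1 huU).2
  have hW3 : (insert u ({x, y} : Finset ℕ)).card = 3 := by
    rw [Finset.card_insert_of_notMem huW, hWc]
  have hW3s : insert u ({x, y} : Finset ℕ) ⊆ Finset.Icc 1 n :=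
    Finset.insert_subset (Finset.mem_sdiff.1 huU).1 hWs
  by_cases hex : ∃ F ∈ 𝓖, x ∈ F ∧ y ∈ F ∧ u ∉ F ∧ ¬ hit (Finset.Icc 1 n \ insert u {x, y}) 1 F
  · obtain ⟨F, hF, hxF, hyF, huF, hnh⟩ := hex
    have h1 : cnt 𝓖 (fun F => x ∉ F ∧ y ∉ F) ≤ (n - 2).choose (k - 3) := by
      have := trace_count (t := 3) hGG (S := ∅) hWs (Q := fun F => x ∉ F ∧ y ∉ F) ?_
      · simpa [hWc] using this
      intro G hGm hq
      refine ⟨?_, ?_⟩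
      · ext z; simp only [Finset.mem_inter, Finset.mem_insert, Finset.mem_singleton,
          Finset.notMem_empty, iff_false]
        rintro ⟨h1, rfl | rfl⟩ <;> tauto
      obtain ⟨m, hm⟩ := core hGG hS hGm _ F hF rfl (by
        ext z; simp only [Finset.mem_inter, Finset.mem_insert, Finset.mem_singleton,
          Finset.notMem_empty, iff_false]
        rintro ⟨h1, rfl | rfl⟩ <;> tauto)
      refine ⟨m, ?_⟩
      unfold hit at hnh
      push Not at hnh
      have h2 := hnh m
      rw [← sdiff_ins, Finset.inter_erase, Finset.erase_eq_of_notMem (by simp [huF])] at h2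
      by_cases hum : u ≤ m
      · rw [filt_erase huU hum] at hm ⊢
        omega
      · rw [filt_empty (U := G ∩ _) (fun y hy => humin y (Finset.mem_inter.1 hy).2) hum,
          filt_empty (U := F ∩ _) (fun y hy => humin y (Finset.mem_inter.1 hy).2) hum] at hm
        simp at hm
    exact h1.trans (choose_bound hn hn6)
  · exfalso
    push Not at hex
    have h1 : cnt 𝓖 (fun F => x ∈ F ∧ y ∈ F ∧ u ∈ F) ≤ (n - 3).choose (k - 3) := by
      have := trace_count (t := 0) hGG (S := insert u {x, y}) hW3s
        (Q := fun F => x ∈ F ∧ y ∈ F ∧ u ∈ F) ?_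
      · simpa [hW3] using this
      intro F hF hq
      refine ⟨?_, hit_zero _ _⟩
      rw [Finset.inter_eq_right]
      intro z hz
      simp only [Finset.mem_insert, Finset.mem_singleton] at hz
      rcases hz with rfl | rfl | rfl <;> tauto
    have h2 : cnt 𝓖 (fun F => x ∈ F ∧ y ∈ F ∧ u ∉ F) ≤ (n - 3).choose (k - 3) := by
      have := trace_count (t := 1) hGG (S := {x, y}) hW3s
        (Q := fun F => x ∈ F ∧ y ∈ F ∧ u ∉ F) ?_
      · have e : k - 2 - 1 = k - 3 := by omega
        rwa [hW3, hWc, e] at this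
      intro F hF hq
      refine ⟨?_, hex F hF hq.1 hq.2.1 hq.2.2⟩
      ext z
      simp only [Finset.mem_inter, Finset.mem_insert, Finset.mem_singleton]
      constructor
      · rintro ⟨h1, rfl | h⟩ <;> tauto
      · rintro (rfl | rfl) <;> tauto
    have h3 := cnt_add (𝓕 := 𝓖) (Q := fun F => x ∈ F ∧ y ∈ F)
      (Q1 := fun F => x ∈ F ∧ y ∈ F ∧ u ∈ F) (Q2 := fun F => x ∈ F ∧ y ∈ F ∧ u ∉ F)
      (fun F _ h => by tauto)
    omega

/-- all pair degrees are small -/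
def EE (n k : ℕ) (𝓕 : Finset (Finset ℕ)) : Prop :=
  ∀ x ∈ Finset.Icc 1 n, ∀ y ∈ Finset.Icc 1 n, x ≠ y →
    cnt 𝓕 (fun F => x ∈ F ∧ y ∈ F) ≤ 2 * (n - 3).choose (k - 3)

theorem sw_mem_of_ne {a b x : ℕ} {F : Finset ℕ} (h1 : x ≠ a) (h2 : x ≠ b) : x ∈ sw a b F ↔ x ∈ F := by
  simp [sw, h1, h2]

theorem resist {n k : ℕ} (hn : 2 * k ≤ n) (hn6 : 6 ≤ n) {𝓕 : Finset (Finset ℕ)} (hG : Good n k 𝓕)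
    (hE : EE n k 𝓕) {a b : ℕ} (hab : a < b) (ha : a ∈ Finset.Icc 1 n)
    (h : ¬ EE n k (sh a b 𝓕)) : ∃ z ∈ Finset.Icc 1 n, z ≠ a ∧ z ≠ b ∧
      cnt 𝓕 (fun F => a ∉ F ∧ b ∉ F ∧ z ∉ F) ≤ 2 * (n - 3).choose (k - 3) := by
  have key : ∀ x ∈ Finset.Icc 1 n, ∀ y ∈ Finset.Icc 1 n, x ≠ y →
      2 * (n - 3).choose (k - 3) < cnt (sh a b 𝓕) (fun F => x ∈ F ∧ y ∈ F) → x ≠ b ∧ y ≠ b ∧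
        (x = a ∨ y = a) := by
    intro x hx y hy hxy hlt
    have hlow := hE x hx y hy hxy
    have hb : ¬ (x = b ∨ y = b) := by
      intro hb
      have : cnt (sh a b 𝓕) (fun F => x ∈ F ∧ y ∈ F) ≤ cnt 𝓕 (fun F => x ∈ F ∧ y ∈ F) := by
        refine cnt_sub fun F hF hq => mem_sh_of_mem hab.ne hF ?_
        rcases hb with rfl | rfl
        · exact hq.1
        · exact hq.2
      omega
    push Not at hb
    refine ⟨hb.1, hb.2, ?_⟩
    by_contra! hc
    rw [cnt_sh] at hlt
    · omega
    · intro F _ _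
      rw [sw_mem_of_ne hc.1 hb.1, sw_mem_of_ne hc.2 hb.2]
  unfold EE at h
  push Not at h
  obtain ⟨x, hx, y, hy, hxy, hlt⟩ := h
  obtain ⟨hxb, hyb, hor⟩ := key x hx y hy hxy hlt
  have hp := pair_lemma hn hn6 (hG.sh hab.ne ha) hx hy hxy hlt
  have fin : ∀ z, z ≠ a → z ≠ b → cnt 𝓕 (fun F => a ∉ F ∧ b ∉ F ∧ z ∉ F) =
      cnt (sh a b 𝓕) (fun F => a ∉ F ∧ b ∉ F ∧ z ∉ F) := by
    intro z hza hzb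
    rw [cnt_sh]
    intro F hbF haF
    rw [sw_mem_of_ne hza hzb]
    simp [sw, hbF]
  rcases hor with rfl | rfl
  · refine ⟨y, hy, hxy.symm, hyb, ?_⟩
    rw [fin y hxy.symm hyb]
    exact (cnt_mono fun F _ h => ⟨h.1, h.2.2⟩).trans hp
  · refine ⟨x, hx, hxy, hxb, ?_⟩
    rw [fin x hxy hxb]
    exact (cnt_mono fun F _ h => ⟨h.2.2, h.1⟩).trans hp

theorem deg_le {n k : ℕ} {𝓕 : Finset (Finset ℕ)} (hE : EE n k 𝓕) {i a b z : ℕ}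
    (hi : i ∈ Finset.Icc 1 n) (ha : a ∈ Finset.Icc 1 n) (hb : b ∈ Finset.Icc 1 n)
    (hz : z ∈ Finset.Icc 1 n) (hia : i ≠ a) (hib : i ≠ b) (hiz : i ≠ z)
    (hc : cnt 𝓕 (fun F => a ∉ F ∧ b ∉ F ∧ z ∉ F) ≤ 2 * (n - 3).choose (k - 3)) :
    cnt 𝓕 (fun F => i ∈ F) ≤ 8 * (n - 3).choose (k - 3) := by
  have h1 := cnt_add (𝓕 := 𝓕) (Q := fun F => i ∈ F) (Q1 := fun F => a ∉ F ∧ b ∉ F ∧ z ∉ F)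
    (Q2 := fun F => (i ∈ F ∧ a ∈ F) ∨ (i ∈ F ∧ b ∈ F) ∨ (i ∈ F ∧ z ∈ F)) (fun F _ h => by tauto)
  have h2 := cnt_add (𝓕 := 𝓕) (Q := fun F => (i ∈ F ∧ a ∈ F) ∨ (i ∈ F ∧ b ∈ F) ∨ (i ∈ F ∧ z ∈ F))
    (fun F _ h => h)
  have h3 := cnt_add (𝓕 := 𝓕) (Q := fun F => (i ∈ F ∧ b ∈ F) ∨ (i ∈ F ∧ z ∈ F))
    (fun F _ h => h)
  have := hE i hi a ha hia
  have := hE i hi b hb hib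
  have := hE i hi z hz hiz
  omega

theorem stage1 {n k : ℕ} (hn : 2 * k ≤ n) (hn6 : 6 ≤ n) {𝓕 : Finset (Finset ℕ)} (hG : Good n k 𝓕)
    (hE : EE n k 𝓕) (hbig : 36 * (n - 3).choose (k - 3) ≤ 𝓕.card)
    (hT : 0 < (n - 3).choose (k - 3))
    (hdeg : ∀ i ∈ Finset.Icc 1 n, 2 * cnt 𝓕 (fun F => i ∈ F) ≤ 𝓕.card) :
    ∃ 𝓖, Good n k 𝓖 ∧ EE n k 𝓖 ∧ ∃ i ∈ Finset.Icc 1 n,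
      10 * (n - 3).choose (k - 3) ≤ cnt 𝓖 (fun F => i ∈ F) ∧
      16 * (n - 3).choose (k - 3) < cnt 𝓖 (fun F => i ∉ F) := by
  set T := (n - 3).choose (k - 3) with hTd
  by_cases h0 : ∃ i ∈ Finset.Icc 1 n, 10 * T ≤ cnt 𝓕 (fun F => i ∈ F)
  · obtain ⟨i, hi, h⟩ := h0
    refine ⟨𝓕, hG, hE, i, hi, h, ?_⟩
    have := hdeg i hi
    have := cnt_compl 𝓕 (fun F => i ∈ F)
    omega
  push Not at h0
  obtain ⟨𝓖, hGG, ⟨hE', hd'⟩, htr, hS⟩ := driver (n := n) (k := k)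
    (fun 𝓗 => EE n k 𝓗 ∧ ∀ i ∈ Finset.Icc 1 n, cnt 𝓗 (fun F => i ∈ F) < 10 * T) ∅ _ 𝓕 le_rfl hG ⟨hE, h0⟩
  have hcard : 𝓖.card = 𝓕.card := by
    rw [← cnt_true, ← cnt_true, htr]; simp
  rcases hS with hS | ⟨a, b, hab, ha, hb, hP⟩
  · exfalso
    obtain ⟨u, huU, humin⟩ := exists_min (Finset.Icc 1 n \ ∅) (by simp; omega)
    have hc2 : (Finset.Icc 1 n \ insert u ∅).card = n - 1 := by
      rw [← sdiff_ins, Finset.card_erase_of_mem huU]; simp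
    obtain ⟨v, hvU, hvmin⟩ := exists_min (Finset.Icc 1 n \ insert u ∅) (by omega)
    have huI := (Finset.mem_sdiff.1 huU).1
    have hvI := (Finset.mem_sdiff.1 hvU).1
    have hvu : v ≠ u := by rintro rfl; simp at hvU
    have h1 : cnt 𝓖 (fun F => u ∉ F ∧ v ∉ F) ≤ 2 * T := by
      refine le_trans ?_ (choose_bound hn hn6)
      have := trace_count (t := 3) hGG (S := ∅) (W := insert v (insert u ∅)) ?_
        (Q := fun F => u ∉ F ∧ v ∉ F) ?_
      · rw [Finset.card_insert_of_notMem (by simp [hvu])] at this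
        simpa using this
      · intro z hz
        simp only [Finset.mem_insert, Finset.notMem_empty, or_false] at hz
        rcases hz with rfl | rfl <;> assumption
      · intro F hF hq
        refine ⟨?_, two_min hGG hS huU humin hvU hvmin hF (by simp) hq.1 hq.2⟩
        ext z; simp only [Finset.mem_inter, Finset.mem_insert, Finset.notMem_empty, or_false, iff_false]
        rintro ⟨h1, rfl | rfl⟩ <;> tauto
    have h2 := cnt_compl 𝓖 (fun F => u ∈ F)
    have h3 := cnt_add (𝓕 := 𝓖) (Q := fun F => ¬ u ∈ F) (Q1 := fun F => v ∈ F)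
      (Q2 := fun F => u ∉ F ∧ v ∉ F) (fun F _ h => by tauto)
    have := hd' u huI
    have := hd' v hvI
    omega
  · have haI := (Finset.mem_sdiff.1 ha).1
    have hbI := (Finset.mem_sdiff.1 hb).1
    have hGs := hGG.sh hab.ne haI
    have hEs : EE n k (sh a b 𝓖) := by
      by_contra hc
      obtain ⟨z, hz, -, -, hcov⟩ := resist hn hn6 hGG hE' hab haI hc
      have h1 := cnt_compl 𝓖 (fun F => a ∉ F ∧ b ∉ F ∧ z ∉ F)
      have h2 := cnt_add (𝓕 := 𝓖) (Q := fun F => ¬ (a ∉ F ∧ b ∉ F ∧ z ∉ F)) (Q1 := fun F => a ∈ F)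
        (Q2 := fun F => b ∈ F ∨ z ∈ F) (fun F _ h => by tauto)
      have h3 := cnt_add (𝓕 := 𝓖) (Q := fun F => b ∈ F ∨ z ∈ F) (fun F _ h => h)
      have := hd' a haI
      have := hd' b hbI
      have := hd' z hz
      omega
    have hP2 : ∃ i ∈ Finset.Icc 1 n, 10 * T ≤ cnt (sh a b 𝓖) (fun F => i ∈ F) := by
      by_contra! hc
      exact hP ⟨hEs, hc⟩
    obtain ⟨i, hi, h10⟩ := hP2
    refine ⟨sh a b 𝓖, hGs, hEs, i, hi, h10, ?_⟩
    have hcs : (sh a b 𝓖).card = 𝓖.card := by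
      rw [← cnt_true, ← cnt_true, cnt_sh]; simp
    have h1 := cnt_compl (sh a b 𝓖) (fun F => i ∈ F)
    have h20 : cnt (sh a b 𝓖) (fun F => i ∈ F) < 20 * T := by
      by_cases hib : i = a ∨ i = b
      · have h3 : cnt (sh a b 𝓖) (fun F => i ∈ F) ≤ cnt (sh a b 𝓖) (fun F => a ∈ F ∨ b ∈ F) :=
          cnt_mono fun F _ h => by rcases hib with rfl | rfl <;> tauto
        rw [cnt_sh (Q := fun F => a ∈ F ∨ b ∈ F) (by intro F hb ha; simp [sw, hb])] at h3
        have h4 := cnt_add (𝓕 := 𝓖) (Q := fun F => a ∈ F ∨ b ∈ F) (fun F _ h => h)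
        have := hd' a haI
        have := hd' b hbI
        omega
      · push Not at hib
        rw [cnt_sh (fun F _ _ => sw_mem_of_ne hib.1 hib.2)]
        have := hd' i hi
        omega
    omega

theorem stage2 {n k : ℕ} (hn : 2 * k ≤ n) (hn6 : 6 ≤ n) {𝓕 : Finset (Finset ℕ)} (hG : Good n k 𝓕)
    (hE : EE n k 𝓕) (hT : 0 < (n - 3).choose (k - 3)) {i : ℕ} (hi : i ∈ Finset.Icc 1 n)
    (h10 : 10 * (n - 3).choose (k - 3) ≤ cnt 𝓕 (fun F => i ∈ F))
    (h16 : 16 * (n - 3).choose (k - 3) < cnt 𝓕 (fun F => i ∉ F)) :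
    ∃ 𝓖, Good n k 𝓖 ∧ EE n k 𝓖 ∧ 10 * (n - 3).choose (k - 3) ≤ cnt 𝓖 (fun F => i ∈ F) ∧
      16 * (n - 3).choose (k - 3) < cnt 𝓖 (fun F => i ∉ F) ∧
      ∃ x ∈ Finset.Icc 1 n, ∃ y ∈ Finset.Icc 1 n, x ≠ i ∧ y ≠ i ∧ x ≠ y ∧
        cnt 𝓖 (fun F => i ∉ F ∧ x ∉ F ∧ y ∉ F) ≤ 2 * (n - 3).choose (k - 3) := by
  obtain ⟨𝓖, hGG, hE', htr, hS⟩ := driver (n := n) (k := k) (EE n k) {i} _ 𝓕 le_rfl hG hE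
  rw [← htr _ (by intro F; simp)] at h10 h16
  refine ⟨𝓖, hGG, hE', h10, h16, ?_⟩
  rcases hS with hS | ⟨a, b, hab, ha, hb, hP⟩
  · have hc1 : (Finset.Icc 1 n \ {i}).card = n - 1 := by
      rw [Finset.card_sdiff_of_subset (by simpa using hi)]; simp
    obtain ⟨u, huU, humin⟩ := exists_min (Finset.Icc 1 n \ {i}) (by omega)
    have hc2 : (Finset.Icc 1 n \ insert u {i}).card = n - 1 - 1 := by
      rw [← sdiff_ins, Finset.card_erase_of_mem huU, hc1]
    obtain ⟨v, hvU, hvmin⟩ := exists_min (Finset.Icc 1 n \ insert u {i}) (by omega)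
    have huI := (Finset.mem_sdiff.1 huU).1
    have hvI := (Finset.mem_sdiff.1 hvU).1
    have hui : u ≠ i := by rintro rfl; simp at huU
    have hvu : v ≠ u := by rintro rfl; simp at hvU
    have hvi : v ≠ i := by rintro rfl; simp at hvU
    refine ⟨u, huI, v, hvI, hui, hvi, hvu.symm, ?_⟩
    have h3 : (insert v (insert u {i}) : Finset ℕ).card = 3 := by
      rw [Finset.card_insert_of_notMem (by simp [hvu, hvi]), Finset.card_pair hui]
    have := trace_count (t := 3) hGG (S := ∅) (W := insert v (insert u {i})) ?_
        (Q := fun F => i ∉ F ∧ u ∉ F ∧ v ∉ F) ?_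
    · rw [h3] at this
      simp only [Finset.card_empty, Nat.sub_zero] at this
      omega
    · intro z hz
      simp only [Finset.mem_insert, Finset.mem_singleton] at hz
      rcases hz with rfl | rfl | rfl <;> assumption
    · intro F hF hq
      refine ⟨?_, two_min hGG hS huU humin hvU hvmin hF (by simp [hq.1]) hq.2.1 hq.2.2⟩
      ext z; simp only [Finset.mem_inter, Finset.mem_insert, Finset.mem_singleton,
        Finset.notMem_empty, iff_false]
      rintro ⟨h1, rfl | rfl | rfl⟩ <;> tauto
  · simp only [Finset.mem_sdiff, Finset.mem_singleton] at ha hb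
    obtain ⟨z, hz, hza, hzb, hcov⟩ := resist hn hn6 hGG hE' hab ha.1 hP
    by_cases hzi : z = i
    · subst hzi
      exact ⟨a, ha.1, b, hb.1, ha.2, hb.2, hab.ne,
        (cnt_mono fun F _ h => ⟨h.2.1, h.2.2, h.1⟩).trans hcov⟩
    · exfalso
      have := deg_le hE' hi ha.1 hb.1 hz (Ne.symm ha.2) (Ne.symm hb.2) (Ne.symm hzi) hcov
      omega

theorem single_small {n k : ℕ} (hn6 : 6 ≤ n) {𝓖 : Finset (Finset ℕ)} (hG : Good n k 𝓖)
    (hE : EE n k 𝓖) {i x y : ℕ} (hi : i ∈ Finset.Icc 1 n) (hx : x ∈ Finset.Icc 1 n)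
    (hy : y ∈ Finset.Icc 1 n) (hxi : x ≠ i) (hyi : y ≠ i) (hxy : x ≠ y)
    (hS : Shifted (Finset.Icc 1 n \ {i, x, y}) 𝓖)
    (hbig : 3 * (n - 3).choose (k - 3) < cnt 𝓖 (fun F => i ∈ F ∧ x ∉ F ∧ y ∉ F)) :
    cnt 𝓖 (fun F => i ∉ F ∧ x ∈ F ∧ y ∉ F) ≤ (n - 3).choose (k - 3) := by
  have hW3 : ({i, x, y} : Finset ℕ).card = 3 := by
    rw [Finset.card_insert_of_notMem (by simp [hxi.symm, hyi.symm]), Finset.card_pair hxy]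
  have hWs : ({i, x, y} : Finset ℕ) ⊆ Finset.Icc 1 n := by
    intro z hz
    simp only [Finset.mem_insert, Finset.mem_singleton] at hz
    rcases hz with rfl | rfl | rfl <;> assumption
  have hUc : (Finset.Icc 1 n \ {i, x, y}).card = n - 3 := by
    rw [Finset.card_sdiff_of_subset hWs, hW3]; simp
  obtain ⟨w, hwU, hwmin⟩ := exists_min (Finset.Icc 1 n \ {i, x, y}) (by omega)
  have hwI := (Finset.mem_sdiff.1 hwU).1
  have hwW := (Finset.mem_sdiff.1 hwU).2
  have hwi : i ≠ w := by rintro rfl; simp at hwW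
  have hW4 : (insert w {i, x, y} : Finset ℕ).card = 4 := by
    rw [Finset.card_insert_of_notMem hwW, hW3]
  by_cases hex : ∃ F ∈ 𝓖, i ∈ F ∧ x ∉ F ∧ y ∉ F ∧ ¬ hit (Finset.Icc 1 n \ {i, x, y}) 1 F
  · obtain ⟨F, hF, hiF, hxF, hyF, hnh⟩ := hex
    have := trace_count (t := 2) hG (S := {x}) hWs (Q := fun F => i ∉ F ∧ x ∈ F ∧ y ∉ F) ?_
    · have e : k - 1 - 2 = k - 3 := by omega
      rwa [hW3, Finset.card_singleton, e] at this
    intro G hGm hq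
    refine ⟨?_, ?_⟩
    · ext z; simp only [Finset.mem_inter, Finset.mem_insert, Finset.mem_singleton]
      constructor
      · rintro ⟨h1, rfl | rfl | rfl⟩ <;> tauto
      · rintro rfl; tauto
    obtain ⟨m, hm⟩ := core hG hS hGm _ F hF rfl (by
      ext z; simp only [Finset.mem_inter, Finset.mem_insert, Finset.mem_singleton,
        Finset.notMem_empty, iff_false]
      rintro ⟨h1, rfl | rfl | rfl⟩ <;> tauto)
    refine ⟨m, ?_⟩
    unfold hit at hnh
    push Not at hnh
    have h2 := hnh m
    omega
  · exfalso
    push Not at hex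
    have h1 := hE i hi w hwI hwi
    have h2 : cnt 𝓖 (fun F => i ∈ F ∧ x ∉ F ∧ y ∉ F ∧ w ∉ F) ≤ (n - 4).choose (k - 3) := by
      have := trace_count (t := 2) hG (S := {i}) (Finset.insert_subset hwI hWs)
        (Q := fun F => i ∈ F ∧ x ∉ F ∧ y ∉ F ∧ w ∉ F) ?_
      · have e : k - 1 - 2 = k - 3 := by omega
        rwa [hW4, Finset.card_singleton, e] at this
      intro F hF hq
      refine ⟨?_, ?_⟩
      · ext z; simp only [Finset.mem_inter, Finset.mem_insert, Finset.mem_singleton]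
        constructor
        · rintro ⟨h1, rfl | rfl | rfl | rfl⟩ <;> tauto
        · rintro rfl; tauto
      · have := hit_erase hwU hwmin hq.2.2.2 (hex F hF hq.1 hq.2.1 hq.2.2.1)
        rwa [sdiff_ins] at this
    have h3 : (n - 4).choose (k - 3) ≤ (n - 3).choose (k - 3) := Nat.choose_le_choose _ (by omega)
    have h4 := cnt_add (𝓕 := 𝓖) (Q := fun F => i ∈ F ∧ x ∉ F ∧ y ∉ F) (Q1 := fun F => i ∈ F ∧ w ∈ F)
      (Q2 := fun F => i ∈ F ∧ x ∉ F ∧ y ∉ F ∧ w ∉ F) (fun F _ h => by tauto)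
    omega

theorem stage3 {n k : ℕ} (hn : 2 * k ≤ n) (hn6 : 6 ≤ n) {𝓕 : Finset (Finset ℕ)} (hG : Good n k 𝓕)
    (hE : EE n k 𝓕) (hT : 0 < (n - 3).choose (k - 3)) {i x y : ℕ} (hi : i ∈ Finset.Icc 1 n)
    (h10 : 10 * (n - 3).choose (k - 3) ≤ cnt 𝓕 (fun F => i ∈ F))
    (h16 : 16 * (n - 3).choose (k - 3) < cnt 𝓕 (fun F => i ∉ F))
    (hx : x ∈ Finset.Icc 1 n) (hy : y ∈ Finset.Icc 1 n) (hxi : x ≠ i) (hyi : y ≠ i) (hxy : x ≠ y)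
    (hR : cnt 𝓕 (fun F => i ∉ F ∧ x ∉ F ∧ y ∉ F) ≤ 2 * (n - 3).choose (k - 3)) : False := by
  obtain ⟨𝓖, hGG, hE', htr, hS⟩ := driver (n := n) (k := k) (EE n k) {i, x, y} _ 𝓕 le_rfl hG hE
  rw [← htr _ (by intro F; simp)] at h10 h16 hR
  have hix := hE' i hi x hx hxi.symm
  have hiy := hE' i hi y hy hyi.symm
  have hxy' := hE' x hx y hy hxy
  rcases hS with hS | ⟨a, b, hab, ha, hb, hP⟩
  · have h1 := cnt_add (𝓕 := 𝓖) (Q := fun F => i ∈ F) (Q1 := fun F => i ∈ F ∧ x ∉ F ∧ y ∉ F)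
      (Q2 := fun F => (i ∈ F ∧ x ∈ F) ∨ (i ∈ F ∧ y ∈ F)) (fun F _ h => by tauto)
    have h2 := cnt_add (𝓕 := 𝓖) (Q := fun F => (i ∈ F ∧ x ∈ F) ∨ (i ∈ F ∧ y ∈ F)) (fun F _ h => h)
    have h3 := single_small hn6 hGG hE' hi hx hy hxi hyi hxy hS (by omega)
    have h4 := single_small hn6 hGG hE' hi hy hx hyi hxi hxy.symm
      (by rwa [Finset.pair_comm y x])
      (lt_of_lt_of_le (by omega) (cnt_mono (Q := fun F => i ∈ F ∧ x ∉ F ∧ y ∉ F)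
        fun F _ h => by tauto))
    have h5 := cnt_add (𝓕 := 𝓖) (Q := fun F => i ∉ F) (Q1 := fun F => i ∉ F ∧ x ∉ F ∧ y ∉ F)
      (Q2 := fun F => (x ∈ F ∧ y ∈ F) ∨ (i ∉ F ∧ x ∈ F ∧ y ∉ F) ∨ (i ∉ F ∧ y ∈ F ∧ x ∉ F))
      (fun F _ h => by tauto)
    have h6 := cnt_add (𝓕 := 𝓖)
      (Q := fun F => (x ∈ F ∧ y ∈ F) ∨ (i ∉ F ∧ x ∈ F ∧ y ∉ F) ∨ (i ∉ F ∧ y ∈ F ∧ x ∉ F))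
      (fun F _ h => h)
    have h7 := cnt_add (𝓕 := 𝓖)
      (Q := fun F => (i ∉ F ∧ x ∈ F ∧ y ∉ F) ∨ (i ∉ F ∧ y ∈ F ∧ x ∉ F))
      (fun F _ h => h)
    omega
  · simp only [Finset.mem_sdiff, Finset.mem_insert, Finset.mem_singleton, not_or] at ha hb
    obtain ⟨z, hz, hza, hzb, hcov⟩ := resist hn hn6 hGG hE' hab ha.1 hP
    by_cases hzi : z = i
    · subst hzi
      have h1 := cnt_add (𝓕 := 𝓖) (Q := fun F => z ∉ F) (Q1 := fun F => z ∉ F ∧ x ∉ F ∧ y ∉ F)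
        (Q2 := fun F => z ∉ F ∧ (x ∈ F ∨ y ∈ F)) (fun F _ h => by tauto)
      have h2 := cnt_add (𝓕 := 𝓖) (Q := fun F => z ∉ F ∧ (x ∈ F ∨ y ∈ F))
        (Q1 := fun F => a ∉ F ∧ b ∉ F ∧ z ∉ F)
        (Q2 := fun F => ((x ∈ F ∧ a ∈ F) ∨ (x ∈ F ∧ b ∈ F)) ∨ ((y ∈ F ∧ a ∈ F) ∨ (y ∈ F ∧ b ∈ F)))
        (fun F _ h => by tauto)
      have h3 := cnt_add (𝓕 := 𝓖)
        (Q := fun F => ((x ∈ F ∧ a ∈ F) ∨ (x ∈ F ∧ b ∈ F)) ∨ ((y ∈ F ∧ a ∈ F) ∨ (y ∈ F ∧ b ∈ F)))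
        (fun F _ h => h)
      have h4 := cnt_add (𝓕 := 𝓖) (Q := fun F => (x ∈ F ∧ a ∈ F) ∨ (x ∈ F ∧ b ∈ F)) (fun F _ h => h)
      have h5 := cnt_add (𝓕 := 𝓖) (Q := fun F => (y ∈ F ∧ a ∈ F) ∨ (y ∈ F ∧ b ∈ F)) (fun F _ h => h)
      have := hE' x hx a ha.1 (Ne.symm ha.2.2.1)
      have := hE' x hx b hb.1 (Ne.symm hb.2.2.1)
      have := hE' y hy a ha.1 (Ne.symm ha.2.2.2)
      have := hE' y hy b hb.1 (Ne.symm hb.2.2.2)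
      omega
    · have := deg_le hE' hi ha.1 hb.1 hz (Ne.symm ha.2.1) (Ne.symm hb.2.1) (Ne.symm hzi) hcov
      omega

theorem stmt_7 (n k : ℕ) (hn : 2 * k ≤ n) (𝓕 : Finset (Finset ℕ))
    (h𝓕 : ∀ F ∈ 𝓕, F ⊆ Finset.Icc 1 n ∧ F.card = k)
    (hint : ∀ F ∈ 𝓕, ∀ F' ∈ 𝓕, (F ∩ F').Nonempty)
    (hbig : 36 * (n - 3).choose (k - 3) ≤ 𝓕.card) :
    ∃ i ∈ Finset.Icc 1 n, 𝓕.card < 2 * (𝓕.filter (fun F => i ∈ F)).card := by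
  by_contra! hcon
  have hG : Good n k 𝓕 := ⟨h𝓕, hint⟩
  have hT : 0 < (n - 3).choose (k - 3) := Nat.choose_pos (by omega)
  have hn6 : 6 ≤ n := by
    have h1 : 𝓕.card ≤ 2 ^ n := by
      have h2 : 𝓕 ⊆ (Finset.Icc 1 n).powerset := fun F hF => Finset.mem_powerset.2 (h𝓕 F hF).1
      have := Finset.card_le_card h2
      simpa using this
    by_contra hlt
    have h3 : 2 ^ n ≤ 2 ^ 5 := Nat.pow_le_pow_right (by norm_num) (by omega)
    omega
  have hdeg : ∀ i ∈ Finset.Icc 1 n, 2 * cnt 𝓕 (fun F => i ∈ F) ≤ 𝓕.card := by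
    intro i hi
    have h := hcon i hi
    have e : cnt 𝓕 (fun F => i ∈ F) = (𝓕.filter (fun F => i ∈ F)).card := by
      unfold cnt
      congr
    rwa [e]
  have hE : EE n k 𝓕 := by
    intro x hx y hy hxy
    by_contra! hlt
    have hp := pair_lemma hn hn6 hG hx hy hxy hlt
    have hdx := hdeg x hx
    have hdy := hdeg y hy
    have h1 := cnt_compl 𝓕 (fun F => x ∈ F)
    have h2 := cnt_add (𝓕 := 𝓕) (Q := fun F => ¬ x ∈ F) (Q1 := fun F => y ∈ F ∧ ¬ x ∈ F)
      (Q2 := fun F => x ∉ F ∧ y ∉ F) (fun F _ h => by tauto)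
    have h3 : cnt 𝓕 (fun F => y ∈ F ∧ ¬ x ∈ F) + cnt 𝓕 (fun F => x ∈ F ∧ y ∈ F)
        ≤ cnt 𝓕 (fun F => y ∈ F) := by
      classical
      unfold cnt
      rw [← Finset.card_union_of_disjoint]
      · apply Finset.card_le_card
        intro F hF
        simp only [Finset.mem_union, Finset.mem_filter] at hF ⊢
        tauto
      · rw [Finset.disjoint_left]
        intro F hF hF'
        simp only [Finset.mem_filter] at hF hF'
        tauto
    omega
  obtain ⟨𝓖, hG1, hE1, i, hi, h10, h16⟩ := stage1 hn hn6 hG hE hbig hT hdeg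
  obtain ⟨𝓗, hG2, hE2, h10', h16', x, hx, y, hy, hxi, hyi, hxy, hR⟩ :=
    stage2 hn hn6 hG1 hE1 hT hi h10 h16
  exact stage3 hn hn6 hG2 hE2 hT hi h10' h16' hx hy hxi hyi hxy hR
end
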